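/- The center of the generic mirabolic Hecke algebra ℛ_n over ℂ(q) equals the set of evaluations of symmetric polynomials at the Jucys–Murphy elements: Z(ℛ_n) = { p(L_1, …, L_n) : p ∈ ℂ(q)[x_1, …, x_n] invariant under all permutations of the variables }. -/

import Mathlib

noncomputable section

/-- The relations of Solomon's presentation of the mirabolic Hecke algebra `R_n(K,q)`,
on generators `T_0, T_1, …, T_{n-1}` (indexed by `Fin n`). -/
inductive SolomonRel (K : Type) [Field K] (q : K) (n : ℕ) :
    FreeAlgebra K (Fin n) → FreeAlgebra K (Fin n) → Prop
  | quad0 (i : Fin n) (hi : i.val = 0) :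
      SolomonRel K q n (FreeAlgebra.ι K i * FreeAlgebra.ι K i)
        ((q - 2) • FreeAlgebra.ι K i + (q - 1) • (1 : FreeAlgebra K (Fin n)))
  | quad (i : Fin n) (hi : 1 ≤ i.val) :
      SolomonRel K q n (FreeAlgebra.ι K i * FreeAlgebra.ι K i)
        ((q - 1) • FreeAlgebra.ι K i + q • (1 : FreeAlgebra K (Fin n)))
  | braid (i j : Fin n) (hi : 1 ≤ i.val) (hij : i.val + 1 = j.val) :
      SolomonRel K q n (FreeAlgebra.ι K i * FreeAlgebra.ι K j * FreeAlgebra.ι K i)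
        (FreeAlgebra.ι K j * FreeAlgebra.ι K i * FreeAlgebra.ι K j)
  | rel4 (i j : Fin n) (hi : i.val = 0) (hj : j.val = 1) :
      SolomonRel K q n
        (FreeAlgebra.ι K i * FreeAlgebra.ι K j * FreeAlgebra.ι K i * FreeAlgebra.ι K j)
        ((q - 1) • (FreeAlgebra.ι K j * FreeAlgebra.ι K i * FreeAlgebra.ι K j +
            FreeAlgebra.ι K j * FreeAlgebra.ι K i) -
          FreeAlgebra.ι K i * FreeAlgebra.ι K j * FreeAlgebra.ι K i)
  | rel5 (i j : Fin n) (hi : i.val = 0) (hj : j.val = 1) :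
      SolomonRel K q n
        (FreeAlgebra.ι K j * FreeAlgebra.ι K i * FreeAlgebra.ι K j * FreeAlgebra.ι K i)
        ((q - 1) • (FreeAlgebra.ι K j * FreeAlgebra.ι K i * FreeAlgebra.ι K j +
            FreeAlgebra.ι K i * FreeAlgebra.ι K j) -
          FreeAlgebra.ι K i * FreeAlgebra.ι K j * FreeAlgebra.ι K i)
  | comm (i j : Fin n) (hij : i.val + 2 ≤ j.val ∨ j.val + 2 ≤ i.val) :
      SolomonRel K q n (FreeAlgebra.ι K i * FreeAlgebra.ι K j)
        (FreeAlgebra.ι K j * FreeAlgebra.ι K i)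

/-- The mirabolic Hecke algebra `R_n(K,q)`, presented by Solomon's relations. -/
abbrev MirabolicHecke (K : Type) [Field K] (q : K) (n : ℕ) : Type :=
  RingQuot (SolomonRel K q n)

/-- The generator `T_i` of the mirabolic Hecke algebra. -/
def MirabolicHecke.T {K : Type} [Field K] {q : K} {n : ℕ} (i : Fin n) :
    MirabolicHecke K q n :=
  RingQuot.mkAlgHom K (SolomonRel K q n) (FreeAlgebra.ι K i)


section JM

local notation "K" => RatFunc ℂ
local notation "q" => (RatFunc.X : RatFunc ℂ)

variable (n : ℕ)

/-- The generic mirabolic Hecke algebra `ℛ_n` over `ℂ(q)`. -/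
abbrev GenMirabolic (n : ℕ) : Type := MirabolicHecke K q n

/-- The generator `T_j` of `ℛ_n`, indexed by a natural number (junk value `0` if `j ≥ n`). -/
def Tnat (j : ℕ) : GenMirabolic n :=
  if h : j < n then MirabolicHecke.T ⟨j, h⟩ else 0

/-- The idempotent `e = q⁻¹(T_0 + 1)` of `ℛ_n`. -/
def eElt : GenMirabolic n := q⁻¹ • (Tnat n 0 + 1)

/-- The Jucys–Murphy element `L_i = q^{1−i}·T_{i−1}⋯T_1·e·T_1⋯T_{i−1}` of `ℛ_n`
(for `1 ≤ i ≤ n`; in particular `L_1 = e`). -/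
def JM (i : ℕ) : GenMirabolic n :=
  (q ^ (1 - (i : ℤ))) •
    (((List.range (i - 1)).reverse.map fun k => Tnat n (k + 1)).prod * eElt n *
      ((List.range (i - 1)).map fun k => Tnat n (k + 1)).prod)

end JM

section Eval

local notation "K" => RatFunc ℂ

/-- Evaluation of a multivariate polynomial `p ∈ ℂ(q)[x_1,…,x_n]` at the Jucys–Murphy
elements `L_1, …, L_n` of `ℛ_n`: each monomial `x_1^{s_1}⋯x_n^{s_n}` is evaluated as the
(ordered) product `L_1^{s_1}⋯L_n^{s_n}`.  Since the `L_i` pairwise commute, this is the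
value of `p` at `(L_1, …, L_n)`. -/
def evalJM (n : ℕ) (p : MvPolynomial (Fin n) K) : GenMirabolic n :=
  ∑ s ∈ p.support,
    MvPolynomial.coeff s p • ((List.finRange n).map fun i => JM n (i.val + 1) ^ s i).prod

end Eval

section Combinatorics

variable {K : Type} [Field K]

/-- A set of finite sequences subject to the local rules that govern the content sequences of
standard tableaux (with letter `q ^ c` for content `c`), with a letter `0` freely interspersed. -/
structure IsContentSet (q : K) (S : List K → Prop) : Prop where
  pre : ∀ {a b}, S (a ++ b) → S a
  head : ∀ {x a}, S (x :: a) → x = 0 ∨ x = 1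
  adj : ∀ {u x w}, S (u ++ x :: x :: w) → x = 0
  triple : ∀ {u x y w}, S (u ++ x :: y :: x :: w) → x ≠ 0 → y ≠ q * x ∧ x ≠ q * y
  swap : ∀ {u x y w}, S (u ++ x :: y :: w) → x ≠ y → y ≠ q * x → x ≠ q * y →
    S (u ++ y :: x :: w)

/-- Closure of a set of sequences under admissible transpositions. -/
def SwapClosed (q : K) (S : List K → Prop) : Prop :=
  ∀ u x y w, S (u ++ x :: y :: w) → x ≠ y → y ≠ q * x → x ≠ q * y → S (u ++ y :: x :: w)

variable {q : K} {S : List K → Prop}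

theorem SwapClosed.move_left (hS : SwapClosed q S) {x : K} {v : List K} :
    ∀ {u w : List K}, (∀ y ∈ v, y ≠ x ∧ x ≠ q * y ∧ y ≠ q * x) →
      S (u ++ (v ++ x :: w)) → S (u ++ x :: (v ++ w)) := by
  induction v with
  | nil => intro u w _ h; simpa using h
  | cons y v ih =>
    intro u w hv h
    have h1 : S ((u ++ [y]) ++ x :: (v ++ w)) :=
      ih (fun z hz => hv z (List.mem_cons_of_mem _ hz)) (by simpa using h)
    obtain ⟨h2, h3, h4⟩ := hv y List.mem_cons_self
    simpa using hS u y x (v ++ w) (by simpa using h1) h2 h3 h4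

theorem SwapClosed.move_right (hS : SwapClosed q S) {x : K} {v : List K} :
    ∀ {u w : List K}, (∀ y ∈ v, y ≠ x ∧ x ≠ q * y ∧ y ≠ q * x) →
      S (u ++ x :: (v ++ w)) → S (u ++ (v ++ x :: w)) := by
  induction v with
  | nil => intro u w _ h; simpa using h
  | cons y v ih =>
    intro u w hv h
    obtain ⟨h2, h3, h4⟩ := hv y List.mem_cons_self
    have h1 := hS u x y (v ++ w) (by simpa using h) h2.symm h4 h3
    have h5 : S ((u ++ [y]) ++ (v ++ x :: w)) :=
      ih (fun z hz => hv z (List.mem_cons_of_mem _ hz)) (by simpa using h1)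
    simpa using h5

namespace IsContentSet

theorem swapClosed (h : IsContentSet q S) : SwapClosed q S := fun _ _ _ _ => h.swap

theorem inv (hq : q ≠ 0) (h : IsContentSet q S) : IsContentSet q⁻¹ S where
  pre := h.pre
  head := h.head
  adj := h.adj
  triple := fun ha hx => by
    obtain ⟨h1, h2⟩ := h.triple ha hx
    constructor
    · rintro rfl; exact h2 (by field_simp)
    · rintro rfl; exact h1 (by field_simp)
  swap := fun ha h1 h2 h3 => h.swap ha h1
    (by rintro rfl; exact h3 (by field_simp)) (by rintro rfl; exact h2 (by field_simp))

theorem mul_mem_between (hq : q ≠ 0) (h : IsContentSet q S) (N : ℕ) :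
    ∀ (x : K) (u v w : List K), v.length ≤ N → S (u ++ x :: (v ++ x :: w)) → x ≠ 0 → x ∉ v →
      q * x ∈ v := by
  induction N using Nat.strong_induction_on with
  | _ N ih =>
  intro x u v w hN ha hx hxv
  by_contra hqx
  by_cases hy : q⁻¹ * x ∈ v
  · obtain ⟨v1, v2, hv, hy1⟩ := List.eq_append_cons_of_mem hy
    have hy2 : q⁻¹ * x ∉ v2 := by
      intro hy2
      obtain ⟨v3, v4, rfl, hy3⟩ := List.eq_append_cons_of_mem hy2
      have hmem := ih v3.length (by subst hv; simp at hN; omega) (q⁻¹ * x) (u ++ x :: v1) v3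
        (v4 ++ x :: w) le_rfl (by simpa [hv] using ha) (by simp [hq, hx]) hy3
      rw [mul_inv_cancel_left₀ hq] at hmem
      exact hxv (by simp [hv, hmem])
    have key : ∀ z ∈ v, z ≠ q⁻¹ * x → z ≠ x ∧ x ≠ q * z ∧ z ≠ q * x := fun z hz hne =>
      ⟨fun e => hxv (e ▸ hz), fun e => hne (by rw [e]; field_simp), fun e => hqx (e ▸ hz)⟩
    have b1 : S ((u ++ x :: (v1 ++ [q⁻¹ * x])) ++ x :: (v2 ++ w)) :=
      h.swapClosed.move_left
        (fun z hz => key z (by simp [hv, hz]) (fun e => hy2 (e ▸ hz)))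
        (by simpa [hv] using ha)
    have b2 : S (u ++ (v1 ++ x :: ([q⁻¹ * x, x] ++ (v2 ++ w)))) :=
      h.swapClosed.move_right
        (fun z hz => key z (by simp [hv, hz]) (fun e => hy1 (e ▸ hz)))
        (by simpa using b1)
    have b3 := h.triple (u := u ++ v1) (x := x) (y := q⁻¹ * x) (w := v2 ++ w)
      (by simpa using b2) hx
    exact b3.2 (by field_simp)
  · refine hx (h.adj (u := u) (w := v ++ w) ?_)
    have := h.swapClosed.move_left (u := u ++ [x]) (v := v) (x := x) (w := w)
      (fun z hz => ⟨fun e => hxv (e ▸ hz), fun e => hy (by rw [e]; simpa [hq] using hz),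
        fun e => hqx (e ▸ hz)⟩) (by simpa using ha)
    simpa using this

theorem exists_zpow (hq : q ≠ 0) (h : IsContentSet q S) (N : ℕ) :
    ∀ (y : K) (u : List K), u.length ≤ N → S (u ++ [y]) → y ≠ 0 → y ∉ u →
      ∃ c : ℤ, y = q ^ c ∧ (0 < c → q ^ (c - 1) ∈ u) ∧ (c < 0 → q ^ (c + 1) ∈ u) := by
  induction N using Nat.strong_induction_on with
  | _ N ih =>
  intro y u hN ha hy hyu
  by_cases h1 : q * y ∈ u
  · obtain ⟨u1, u2, rfl, hn⟩ := List.eq_append_cons_of_mem h1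
    obtain ⟨c, hc, hp, -⟩ := ih u1.length (by simp at hN; omega) (q * y) u1 le_rfl
      (h.pre (b := u2 ++ [y]) (by simpa using ha)) (by simp [hq, hy]) hn
    have hyc : y = q ^ (c - 1) := by
      rw [zpow_sub_one₀ hq, ← hc]; field_simp
    have hc0 : ¬ 0 < c := fun h0 => hyu (by
      have := hp h0
      rw [← hyc] at this
      simp [this])
    refine ⟨c - 1, hyc, fun h0 => absurd (by omega) hc0, fun _ => ?_⟩
    rw [sub_add_cancel, ← hc]; exact h1
  by_cases h2 : q⁻¹ * y ∈ u
  · obtain ⟨u1, u2, rfl, hn⟩ := List.eq_append_cons_of_mem h2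
    obtain ⟨c, hc, -, hp⟩ := ih u1.length (by simp at hN; omega) (q⁻¹ * y) u1 le_rfl
      (h.pre (b := u2 ++ [y]) (by simpa using ha)) (by simp [hq, hy]) hn
    have hyc : y = q ^ (c + 1) := by
      rw [zpow_add_one₀ hq, ← hc]; field_simp
    have hc0 : ¬ c < 0 := fun h0 => hyu (by
      have := hp h0
      rw [← hyc] at this
      simp [this])
    refine ⟨c + 1, hyc, fun _ => ?_, fun h0 => absurd (by omega) hc0⟩
    rw [add_sub_cancel_right, ← hc]; exact h2
  · have := h.swapClosed.move_left (u := []) (v := u) (x := y) (w := [])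
      (fun z hz => ⟨fun e => hyu (e ▸ hz), fun e => h2 (by rw [e]; simpa [hq] using hz),
        fun e => h1 (e ▸ hz)⟩) (by simpa using ha)
    rcases h.head (by simpa using this) with h0 | h0
    · exact absurd h0 hy
    · exact ⟨0, by simp [h0], by simp, by simp⟩

end IsContentSet

open Classical in
/-- The subsequence of the letters equal to `x` or `q * x`. -/
def pairFilter (q x : K) (a : List K) : List K := a.filter fun z => z = x ∨ z = q * x

theorem mem_pairFilter {x z : K} {a : List K} :
    z ∈ pairFilter q x a ↔ z ∈ a ∧ (z = x ∨ z = q * x) := by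
  simp [pairFilter]

theorem pairFilter_append (x : K) (a b : List K) :
    pairFilter q x (a ++ b) = pairFilter q x a ++ pairFilter q x b := by
  simp [pairFilter]

theorem exists_of_pairFilter_eq_concat {x z : K} {a g : List K} (h : pairFilter q x a = g ++ [z]) :
    ∃ a0 v, a = a0 ++ z :: v ∧ pairFilter q x a0 = g ∧ x ∉ v ∧ q * x ∉ v ∧ (z = x ∨ z = q * x) := by
  have hz : z ∈ pairFilter q x a := by simp [h]
  unfold pairFilter at h
  rw [List.filter_eq_append_iff] at h
  obtain ⟨l1, l2, rfl, h1, h2⟩ := h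
  rw [List.filter_eq_cons_iff] at h2
  obtain ⟨l3, l4, rfl, h3, -, h4⟩ := h2
  refine ⟨l1 ++ l3, l4, by simp, ?_, ?_, ?_, (mem_pairFilter.1 hz).2⟩
  · rw [pairFilter_append]
    have : pairFilter q x l3 = [] := by
      unfold pairFilter
      rw [List.filter_eq_nil_iff]; simpa using h3
    rw [this, List.append_nil]; exact h1
  · intro hm
    have := (List.filter_eq_nil_iff.1 h4) x hm
    simp at this
  · intro hm
    have := (List.filter_eq_nil_iff.1 h4) _ hm
    simp at this

namespace IsContentSet

theorem pairFilter_eq (hq : q ≠ 0) (hroot : ∀ c : ℤ, q ^ c = 1 → c = 0) (h : IsContentSet q S)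
    {x : K} (hx : x ≠ 0) (g : List K) :
    ∀ (g' a b : List K), S a → S b → pairFilter q x a = g → pairFilter q x b = g' →
      g.length = g'.length → g = g' := by
  have hinj : ∀ c d : ℤ, q ^ c = q ^ d → c = d := fun c d hcd => by
    have := hroot (c - d) (by rw [zpow_sub₀ hq, hcd]; field_simp)
    omega
  have hq1 : q ≠ 1 := fun h1 => by simpa using hroot 1 (by simpa using h1)
  have hxq : x ≠ q * x := fun e => hq1 (by
    have : q * x = 1 * x := by rw [← e, one_mul]
    exact mul_right_cancel₀ hx this)
  induction g using List.reverseRecOn with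
  | nil =>
    intro g' a b _ _ _ _ hl
    exact (List.length_eq_zero_iff.1 hl.symm).symm
  | append_singleton g z ih =>
    intro g' a b ha hb hga hgb hl
    rcases List.eq_nil_or_concat g' with rfl | ⟨g', z', rfl⟩
    · simp at hl
    rw [List.concat_eq_append] at *
    obtain ⟨a0, v, rfl, ha0, -, -, hz⟩ := exists_of_pairFilter_eq_concat hga
    obtain ⟨b0, v', rfl, hb0, -, -, hz'⟩ := exists_of_pairFilter_eq_concat hgb
    have Sa : S (a0 ++ [z]) := h.pre (b := v) (by simpa using ha)
    have Sb : S (b0 ++ [z']) := h.pre (b := v') (by simpa using hb)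
    have hgg : g = g' := ih g' a0 b0 (h.pre Sa) (h.pre Sb) ha0 hb0 (by simpa using hl)
    subst hgg
    -- no letter can follow itself in the filtered subsequence
    have norep : ∀ {y : K} {c p : List K}, S (c ++ [y]) → (y = x ∨ y = q * x) →
        pairFilter q x c = p ++ [y] → False := by
      intro y c p hc hy hp
      obtain ⟨c0, w, rfl, -, h1, h2, -⟩ := exists_of_pairFilter_eq_concat hp
      have hc' : S (c0 ++ y :: (w ++ y :: [])) := by simpa using hc
      rcases hy with rfl | rfl
      · exact h2 (h.mul_mem_between hq _ _ _ _ _ le_rfl hc' hx h1)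
      · have := (h.inv hq).mul_mem_between (inv_ne_zero hq) _ _ _ _ _ le_rfl hc'
          (mul_ne_zero hq hx) h2
        rw [inv_mul_cancel_left₀ hq] at this
        exact h1 this
    -- the first letter of the filtered subsequence is determined
    have first : ∀ {c d : List K}, S (c ++ [x]) → S (d ++ [q * x]) → pairFilter q x c = [] →
        pairFilter q x d = [] → False := by
      intro c d hc hd hc0 hd0
      have nc : ∀ y, (y = x ∨ y = q * x) → y ∉ c := fun y hy hyc => by
        have : y ∈ pairFilter q x c := mem_pairFilter.2 ⟨hyc, hy⟩
        simp [hc0] at this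
      have nd : ∀ y, (y = x ∨ y = q * x) → y ∉ d := fun y hy hyc => by
        have : y ∈ pairFilter q x d := mem_pairFilter.2 ⟨hyc, hy⟩
        simp [hd0] at this
      obtain ⟨k, hk, -, hk2⟩ := h.exists_zpow hq _ x c le_rfl hc hx (nc x (Or.inl rfl))
      obtain ⟨l, hl, hl1, -⟩ := h.exists_zpow hq _ (q * x) d le_rfl hd (mul_ne_zero hq hx)
        (nd _ (Or.inr rfl))
      have hkl : l = k + 1 := hinj _ _ (by rw [← hl, zpow_add_one₀ hq, ← hk, mul_comm])
      by_cases hk0 : k < 0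
      · have := hk2 hk0
        rw [zpow_add_one₀ hq, ← hk, mul_comm] at this
        exact nc _ (Or.inr rfl) this
      · have := hl1 (by omega)
        rw [hkl, add_sub_cancel_right, ← hk] at this
        exact nd _ (Or.inl rfl) this
    rcases List.eq_nil_or_concat g with rfl | ⟨g, y, rfl⟩
    · rcases hz with rfl | rfl <;> rcases hz' with rfl | rfl
      · rfl
      · exact (first Sa Sb ha0 hb0).elim
      · exact (first Sb Sa hb0 ha0).elim
      · rfl
    · rw [List.concat_eq_append] at *
      have hy : y = x ∨ y = q * x :=
        (mem_pairFilter.1 (by rw [ha0]; simp : y ∈ pairFilter q x a0)).2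
      have hyz : y ≠ z := by rintro rfl; exact norep Sa hz ha0
      have hyz' : y ≠ z' := by rintro rfl; exact norep Sb hz' hb0
      have : z = z' := by grind
      rw [this]

theorem not_both_extensions (hq : q ≠ 0) (hroot : ∀ c : ℤ, q ^ c = 1 → c = 0)
    (h : IsContentSet q S) {x : K} (hx : x ≠ 0) {b : List K} (h1 : S (b ++ [x]))
    (h2 : S (b ++ [q * x])) : False := by
  have := h.pairFilter_eq hq hroot hx _ _ _ _ h1 h2 rfl rfl (by
    simp [pairFilter])
  simp only [pairFilter_append, List.append_cancel_left_eq] at this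
  have hq1 : q ≠ 1 := fun h1 => by simpa using hroot 1 (by simpa using h1)
  simp [pairFilter] at this
  exact hq1 (by
    have : q * x = 1 * x := by rw [← this, one_mul]
    exact mul_right_cancel₀ hx this)

theorem notMem_of_perm (hq : q ≠ 0) (hroot : ∀ c : ℤ, q ^ c = 1 → c = 0) (h : IsContentSet q S)
    {x y z : K} (hy : y ≠ 0) (hxy : x = y ∨ x = q * y) (hz : z = y ∨ z = q * y)
    {u v b : List K} (ha : S (u ++ x :: v)) (hb : S (b ++ [x]))
    (hp : (u ++ x :: v).Perm (b ++ [x])) (hxv : x ∉ v) : z ∉ v := by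
  intro hzv
  have := h.pairFilter_eq hq hroot hy _ _ _ _ ha hb rfl rfl (by
    unfold pairFilter; exact (hp.filter _).length_eq)
  have h1 : pairFilter q y [x] = [x] := by
    unfold pairFilter; simpa using hxy
  have hne : pairFilter q y v ≠ [] :=
    List.ne_nil_of_mem (mem_pairFilter.2 ⟨hzv, hz⟩)
  rw [show u ++ x :: v = (u ++ [x]) ++ v by simp, pairFilter_append (q := q) y (u ++ [x]) v,
    pairFilter_append (q := q) y b, h1] at this
  have h2 := congrArg List.getLast? this
  rw [List.getLast?_append_of_ne_nil _ hne, List.getLast?_concat] at h2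
  exact hxv (mem_pairFilter.1 (List.mem_of_getLast? h2)).1

theorem of_perm (hq : q ≠ 0) (hroot : ∀ c : ℤ, q ^ c = 1 → c = 0) (h : IsContentSet q S)
    (b : List K) : ∀ (S' : List K → Prop) (a : List K), SwapClosed q S' → (∀ c, S' c → S c) →
      S' a → S b → a.Perm b → S' b := by
  induction b using List.reverseRecOn with
  | nil => intro S' a _ _ ha _ hp; rwa [hp.eq_nil] at ha
  | append_singleton b x ih =>
    intro S' a hsw hsub ha hb hp
    have hxa : x ∈ a := hp.mem_iff.2 (by simp)
    obtain ⟨u, v, rfl, hxv⟩ : ∃ u v, a = u ++ x :: v ∧ x ∉ v := by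
      obtain ⟨s, t, hst, hs⟩ := List.eq_append_cons_of_mem (List.mem_reverse.2 hxa)
      refine ⟨t.reverse, s.reverse, ?_, by simpa using hs⟩
      rw [← List.reverse_reverse a, hst]; simp
    have hadm : ∀ y ∈ v, y ≠ x ∧ x ≠ q * y ∧ y ≠ q * x := by
      intro y hy
      have hyx : y ≠ x := fun e => hxv (e ▸ hy)
      refine ⟨hyx, ?_, ?_⟩
      · rintro rfl
        by_cases hy0 : y = 0
        · subst hy0; simp at hyx
        exact h.notMem_of_perm hq hroot hy0 (Or.inr rfl) (Or.inl rfl) (hsub _ ha) hb hp hxv hy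
      · rintro rfl
        by_cases hx0 : x = 0
        · subst hx0; simp at hyx
        exact h.notMem_of_perm hq hroot hx0 (Or.inl rfl) (Or.inr rfl) (hsub _ ha) hb hp hxv hy
    have hmove : S' ((u ++ v) ++ [x]) := by
      have := hsw.move_right (u := u) (v := v) (x := x) (w := []) hadm (by simpa using ha)
      simpa using this
    refine ih (fun c => S' (c ++ [x])) (u ++ v) ?_ (fun c hc => h.pre (hsub _ hc)) hmove
      (h.pre hb) ?_
    · intro u' y z w hS h1 h2 h3
      have := hsw u' y z (w ++ [x]) (by simpa using hS) h1 h2 h3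
      simpa using this
    · have h1 : (x :: (u ++ v)).Perm (x :: b) :=
        (List.perm_middle.symm.trans hp).trans (List.perm_append_singleton x b)
      exact h1.cons_inv

end IsContentSet

end Combinatorics

section Abstract

variable {K : Type} [Field K] {A : Type} [Ring A] [Algebra K A]

/-- The relations of the mirabolic Hecke algebra in terms of the idempotent `e` and of
`t i = T_{i+1}`. -/
structure IsMirabolic (q : K) (n : ℕ) (e : A) (t : ℕ → A) : Prop where
  e_mul_e : 0 < n → e * e = e
  quad : ∀ i, i + 1 < n → t i * t i = (q - 1) • t i + q • (1 : A)
  braid : ∀ i, i + 2 < n → t i * t (i + 1) * t i = t (i + 1) * t i * t (i + 1)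
  comm : ∀ i j, i + 2 ≤ j → j + 1 < n → Commute (t i) (t j)
  e_comm : ∀ j, 1 ≤ j → j + 1 < n → Commute e (t j)
  e_braid : 1 < n → e * t 0 * e * t 0 = t 0 * e * t 0 * e
  e_rel : 1 < n → t 0 * e * t 0 * (1 - e) = (1 - e) * t 0 * (1 - e) + (1 - e)

/-- The Jucys–Murphy elements, indexed from `0`. -/
def jm (q : K) (e : A) (t : ℕ → A) : ℕ → A
  | 0 => e
  | i + 1 => q⁻¹ • (t i * jm q e t i * t i)

/-- The element intertwining the `i`-th and `(i+1)`-st Jucys–Murphy elements. -/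
def intertwiner (q : K) (e : A) (t : ℕ → A) (i : ℕ) : A :=
  t i * (jm q e t i - jm q e t (i + 1)) + (q - 1) • jm q e t (i + 1)

namespace IsMirabolic

variable {q : K} {n : ℕ} {e : A} {t : ℕ → A}

theorem t_mul_t_mul (h : IsMirabolic q n e t) {i : ℕ} (hi : i + 1 < n) (v : A) :
    t i * (t i * v) = (q - 1) • (t i * v) + q • v := by
  rw [← mul_assoc, h.quad i hi]; simp [add_mul]

theorem braid_mul (h : IsMirabolic q n e t) {i : ℕ} (hi : i + 2 < n) (v : A) :
    t i * (t (i + 1) * (t i * v)) = t (i + 1) * (t i * (t (i + 1) * v)) := by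
  have := congrArg (· * v) (h.braid i hi)
  simpa [mul_assoc] using this

theorem eq_of_t_mul_eq (h : IsMirabolic q n e t) (hq : q ≠ 0) {i : ℕ} (hi : i + 1 < n)
    {v w : A} (hvw : t i * v = t i * w) : v = w := by
  have h1 := h.t_mul_t_mul hi v
  rw [hvw, h.t_mul_t_mul hi w] at h1
  have h2 : q • v = q • w := by simpa using h1.symm
  exact smul_right_injective A hq h2

theorem commute_t_jm_of_lt (h : IsMirabolic q n e t) {i j : ℕ} (hij : i < j) (hj : j + 1 < n) :
    Commute (t j) (jm q e t i) := by
  induction i with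
  | zero => exact (h.e_comm j hij hj).symm
  | succ i ih =>
    have h1 := (h.comm i j (by omega) hj).symm
    exact ((h1.mul_right (ih (by omega))).mul_right h1).smul_right _

theorem commute_t_jm_of_gt (h : IsMirabolic q n e t) {i j : ℕ} (hij : j + 2 ≤ i) (hi : i < n) :
    Commute (t j) (jm q e t i) := by
  induction i, hij using Nat.le_induction with
  | base =>
    simp only [jm, mul_smul_comm, smul_mul_assoc, smul_smul]
    refine Commute.smul_right ?_ _
    have hb := h.braid j hi
    have hc : Commute (t (j + 1)) (jm q e t j) := h.commute_t_jm_of_lt (by omega) hi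
    generalize jm q e t j = L at *
    change t j * _ = _ * t j
    calc t j * (t (j + 1) * (t j * L * t j) * t (j + 1))
        = (t j * t (j + 1) * t j) * L * t j * t (j + 1) := by simp only [mul_assoc]
      _ = t (j + 1) * t j * (t (j + 1) * L) * t j * t (j + 1) := by rw [hb]; simp only [mul_assoc]
      _ = t (j + 1) * t j * L * (t (j + 1) * t j * t (j + 1)) := by
          rw [hc.eq]; simp only [mul_assoc]
      _ = t (j + 1) * (t j * L * t j) * t (j + 1) * t j := by rw [← hb]; simp only [mul_assoc]
  | succ i hij ih =>
    have h1 := h.comm j i (by omega) (by omega)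
    exact ((h1.mul_right (ih (by omega))).mul_right h1).smul_right _

theorem commute_jm (h : IsMirabolic q n e t) {i j : ℕ} (hi : i < n) (hj : j < n) :
    Commute (jm q e t i) (jm q e t j) := by
  have aux : ∀ i j, i < j → j < n → Commute (jm q e t i) (jm q e t j) := by
    intro i
    induction i with
    | zero =>
      intro j h0 hj
      match j with
      | 1 =>
        refine Commute.smul_right ?_ _
        have := h.e_braid hj
        change e * (t 0 * e * t 0) = t 0 * e * t 0 * e
        rw [← this]; simp only [mul_assoc]
      | j + 2 =>
        have h1 := h.e_comm (j + 1) (by omega) (by omega)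
        clear h0
        have h3 : ∀ k, k + 1 < n → Commute e (jm q e t (k + 1)) := by
          intro k hk
          induction k with
          | zero =>
            refine Commute.smul_right ?_ _
            have := h.e_braid hk
            change e * (t 0 * e * t 0) = t 0 * e * t 0 * e
            rw [← this]; simp only [mul_assoc]
          | succ k ihk =>
            have h1 := h.e_comm (k + 1) (by omega) (by omega)
            exact ((h1.mul_right (ihk (by omega))).mul_right h1).smul_right _
        exact h3 _ hj
    | succ i ih =>
      intro j hij hj
      have h1 := h.commute_t_jm_of_gt (i := j) (j := i) (by omega) hj
      exact ((h1.mul_left (ih j (by omega) hj)).mul_left h1).smul_left _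
  rcases lt_trichotomy i j with h1 | rfl | h1
  · exact aux i j h1 hj
  · exact Commute.refl _
  · exact (aux j i h1 hi).symm

theorem t_mul_jm_succ (h : IsMirabolic q n e t) (hq : q ≠ 0) {i : ℕ} (hi : i + 1 < n) :
    t i * jm q e t (i + 1) = (q - 1) • jm q e t (i + 1) + jm q e t i * t i := by
  simp only [jm, mul_smul_comm, ← mul_assoc]
  rw [h.quad i hi]
  simp only [add_mul, smul_mul_assoc, one_mul, smul_add]
  rw [smul_comm, inv_smul_smul₀ hq]

theorem jm_succ_mul_t (h : IsMirabolic q n e t) (hq : q ≠ 0) {i : ℕ} (hi : i + 1 < n) :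
    jm q e t (i + 1) * t i = (q - 1) • jm q e t (i + 1) + t i * jm q e t i := by
  simp only [jm, smul_mul_assoc, mul_assoc]
  rw [h.quad i hi]
  simp only [mul_add, mul_smul_comm, mul_one, smul_add]
  rw [smul_comm, inv_smul_smul₀ hq]

theorem jm_succ_mul_t_mul (h : IsMirabolic q n e t) (hq : q ≠ 0) {i : ℕ} (hi : i + 1 < n) (v : A) :
    jm q e t (i + 1) * (t i * v) = (q - 1) • (jm q e t (i + 1) * v) + t i * (jm q e t i * v) := by
  rw [← mul_assoc, h.jm_succ_mul_t hq hi, add_mul, smul_mul_assoc, mul_assoc]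

theorem jm_mul_t_mul (h : IsMirabolic q n e t) (hq : q ≠ 0) {i : ℕ} (hi : i + 1 < n) (v : A) :
    jm q e t i * (t i * v) = t i * (jm q e t (i + 1) * v) - (q - 1) • (jm q e t (i + 1) * v) := by
  rw [← mul_assoc, ← mul_assoc, h.t_mul_jm_succ hq hi, add_mul, smul_mul_assoc, mul_assoc]
  abel

theorem jm_succ_mul_jm_mul (h : IsMirabolic q n e t) {i : ℕ} (hi : i + 1 < n) (v : A) :
    jm q e t (i + 1) * (jm q e t i * v) = jm q e t i * (jm q e t (i + 1) * v) :=
  (h.commute_jm hi (by omega)).left_comm v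

theorem intertwiner_mul (q : K) (e : A) (t : ℕ → A) (i : ℕ) (v : A) :
    intertwiner q e t i * v = t i * (jm q e t i * v) - t i * (jm q e t (i + 1) * v)
      + (q - 1) • (jm q e t (i + 1) * v) := by
  simp [intertwiner, add_mul, sub_mul, mul_sub, mul_assoc]

theorem jm_mul_intertwiner (h : IsMirabolic q n e t) (hq : q ≠ 0) {i : ℕ} (hi : i + 1 < n) :
    jm q e t i * intertwiner q e t i = intertwiner q e t i * jm q e t (i + 1) := by
  rw [← mul_one (jm q e t i * intertwiner q e t i), ← mul_one (jm q e t (i + 1)), mul_assoc]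
  simp only [intertwiner_mul, mul_add, mul_sub, mul_smul_comm, h.jm_mul_t_mul hq hi,
    h.jm_succ_mul_jm_mul hi]
  module

theorem jm_succ_mul_intertwiner (h : IsMirabolic q n e t) (hq : q ≠ 0) {i : ℕ} (hi : i + 1 < n) :
    jm q e t (i + 1) * intertwiner q e t i = intertwiner q e t i * jm q e t i := by
  rw [← mul_one (jm q e t (i + 1) * intertwiner q e t i), ← mul_one (jm q e t i), mul_assoc]
  simp only [intertwiner_mul, mul_add, mul_sub, mul_smul_comm, h.jm_succ_mul_t_mul hq hi,
    h.jm_succ_mul_jm_mul hi]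
  module

theorem intertwiner_mul_intertwiner_mul (h : IsMirabolic q n e t) (hq : q ≠ 0) {i : ℕ}
    (hi : i + 1 < n) (v : A) :
    intertwiner q e t i * (intertwiner q e t i * v) =
      (jm q e t i - q • jm q e t (i + 1)) * ((jm q e t (i + 1) - q • jm q e t i) * v) := by
  simp only [intertwiner_mul, mul_add, mul_sub, sub_mul, smul_mul_assoc, mul_smul_comm,
    h.jm_succ_mul_t_mul hq hi, h.jm_mul_t_mul hq hi, h.t_mul_t_mul hi, h.jm_succ_mul_jm_mul hi]
  module

theorem commute_jm_intertwiner (h : IsMirabolic q n e t) {i j : ℕ} (hi : i + 1 < n) (hj : j < n)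
    (h1 : j ≠ i) (h2 : j ≠ i + 1) : Commute (jm q e t j) (intertwiner q e t i) := by
  have ht : Commute (jm q e t j) (t i) := by
    rcases Nat.lt_or_ge j i with h3 | h3
    · exact (h.commute_t_jm_of_lt h3 hi).symm
    · exact (h.commute_t_jm_of_gt (by omega) hj).symm
  exact (ht.mul_right ((h.commute_jm hj (by omega)).sub_right (h.commute_jm hj hi))).add_right
    ((h.commute_jm hj hi).smul_right _)

end IsMirabolic

/-- `v` is a joint eigenvector for left multiplication by `L 0, L 1, …`, with eigenvalues `a`. -/
def IsWeight (L : ℕ → A) (a : List K) (v : A) : Prop :=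
  ∀ i x, a[i]? = some x → L i * v = x • v

namespace IsWeight

variable {L : ℕ → A} {a b : List K} {x : K} {v w : A}

theorem of_append (h : IsWeight L (a ++ b) v) : IsWeight L a v := fun i x hx => by
  obtain ⟨hi, -⟩ := List.getElem?_eq_some_iff.1 hx
  exact h i x (by rw [List.getElem?_append_left hi, hx])

theorem mul_eq (h : IsWeight L (a ++ x :: b) v) : L a.length * v = x • v :=
  h _ _ (by simp)

theorem concat (h : IsWeight L a v) (hx : L a.length * v = x • v) : IsWeight L (a ++ [x]) v := by
  intro i y hy
  rcases lt_trichotomy i a.length with hi | rfl | hi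
  · exact h i y (by rwa [List.getElem?_append_left hi] at hy)
  · have : x = y := by simpa using hy
    rw [← this, hx]
  · rw [List.getElem?_eq_none (by simp; omega)] at hy
    simp at hy

theorem commute_mul (h : IsWeight L a v) {c : A} (hc : ∀ i < a.length, Commute (L i) c) :
    IsWeight L a (c * v) := fun i x hx => by
  obtain ⟨hi, -⟩ := List.getElem?_eq_some_iff.1 hx
  rw [(hc i hi).left_comm, h i x hx, mul_smul_comm]

theorem mul_right (h : IsWeight L a v) (w : A) : IsWeight L a (v * w) := fun i x hx => by
  rw [← mul_assoc, h i x hx, smul_mul_assoc]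

end IsWeight

open Polynomial in
theorem aeval_mul_of_mul_eq_smul {L v : A} {x : K} (h : L * v = x • v) (P : K[X]) :
    aeval L P * v = P.eval x • v := by
  induction P using Polynomial.induction_on' with
  | add P Q hP hQ => simp [add_mul, hP, hQ, add_smul]
  | monomial k c =>
    have : L ^ k * v = x ^ k • v := by
      induction k with
      | zero => simp
      | succ k ih => rw [pow_succ, mul_assoc, h, mul_smul_comm, ih, smul_smul, pow_succ']
    simp [aeval_monomial, this, ← Algebra.smul_def, smul_smul]

open Polynomial in
theorem commute_aeval {L c : A} (h : Commute L c) (P : K[X]) : Commute (aeval L P) c := by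
  induction P using Polynomial.induction_on' with
  | add P Q hP hQ => simpa using hP.add_left hQ
  | monomial k c' =>
    rw [aeval_monomial]
    exact (Algebra.commute_algebraMap_left c' c).mul_left (h.pow_left k)

open Polynomial in
/-- On vectors of weight `a`, the next Jucys–Murphy element acts diagonalizably. -/
def HasSimpleSpectrum (L : ℕ → A) (a : List K) : Prop :=
  ∀ v, IsWeight L a v → ∃ F : Finset K, aeval (L a.length) (∏ y ∈ F, (X - C y)) * v = 0

namespace IsMirabolic

open Polynomial

variable {q : K} {n : ℕ} {e : A} {t : ℕ → A}

theorem isWeight_swap (h : IsMirabolic q n e t) (hq : q ≠ 0) {u w : List K} {x y : K} {v : A}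
    (hn : (u ++ x :: y :: w).length ≤ n) (hv : IsWeight (jm q e t) (u ++ x :: y :: w) v) :
    IsWeight (jm q e t) (u ++ y :: x :: w) (intertwiner q e t u.length * v) := by
  simp only [List.length_append, List.length_cons] at hn
  intro j z hz
  have hjn : j < n := by
    obtain ⟨hj, -⟩ := List.getElem?_eq_some_iff.1 hz
    simp only [List.length_append, List.length_cons] at hj
    omega
  have hx := hv.mul_eq
  have hy : jm q e t (u.length + 1) * v = y • v := hv _ _ (by simp)
  have key : j ≠ u.length → j ≠ u.length + 1 → (u ++ x :: y :: w)[j]? = some z →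
      jm q e t j * (intertwiner q e t u.length * v) = z • (intertwiner q e t u.length * v) :=
    fun h1 h2 h3 => by
      rw [(h.commute_jm_intertwiner (by omega) hjn h1 h2).left_comm, hv j z h3, mul_smul_comm]
  rcases Nat.lt_or_ge j u.length with hj | hj
  · refine key (by omega) (by omega) ?_
    rw [List.getElem?_append_left hj] at hz ⊢
    exact hz
  · obtain ⟨k, rfl⟩ := Nat.exists_eq_add_of_le hj
    match k with
    | 0 =>
      have : y = z := by simpa using hz
      rw [← this, add_zero, ← mul_assoc, h.jm_mul_intertwiner hq (by omega), mul_assoc, hy,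
        mul_smul_comm]
    | 1 =>
      have : x = z := by simpa using hz
      rw [← this, ← mul_assoc, h.jm_succ_mul_intertwiner hq (by omega), mul_assoc, hx,
        mul_smul_comm]
    | k + 2 =>
      refine key (by omega) (by omega) ?_
      rw [List.getElem?_append_right (by omega)] at hz ⊢
      simpa using hz

theorem intertwiner_sq_of_isWeight (h : IsMirabolic q n e t) (hq : q ≠ 0) {u w : List K} {x y : K}
    {v : A} (hn : (u ++ x :: y :: w).length ≤ n)
    (hv : IsWeight (jm q e t) (u ++ x :: y :: w) v) :
    intertwiner q e t u.length * (intertwiner q e t u.length * v) =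
      ((x - q * y) * (y - q * x)) • v := by
  simp only [List.length_append, List.length_cons] at hn
  have hx := hv.mul_eq
  have hy : jm q e t (u.length + 1) * v = y • v := hv _ _ (by simp)
  rw [h.intertwiner_mul_intertwiner_mul hq (by omega)]
  simp only [sub_mul, smul_mul_assoc, hx, hy, mul_sub, mul_smul_comm]
  module

theorem intertwiner_mul_ne_zero (h : IsMirabolic q n e t) (hq : q ≠ 0) {u w : List K} {x y : K}
    {v : A} (hn : (u ++ x :: y :: w).length ≤ n)
    (hv : IsWeight (jm q e t) (u ++ x :: y :: w) v) (h1 : y ≠ q * x) (h2 : x ≠ q * y)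
    (hv0 : v ≠ 0) : intertwiner q e t u.length * v ≠ 0 := by
  intro h0
  have := h.intertwiner_sq_of_isWeight hq hn hv
  rw [h0, mul_zero, eq_comm, smul_eq_zero, mul_eq_zero, sub_eq_zero, sub_eq_zero] at this
  tauto

theorem eq_zero_of_adjacent (h : IsMirabolic q n e t) (hq : q ≠ 0) (hq1 : q ≠ 1)
    {u w : List K} {x : K} {v : A} (hn : (u ++ x :: x :: w).length ≤ n)
    (hu : HasSimpleSpectrum (jm q e t) u) (hv : IsWeight (jm q e t) (u ++ x :: x :: w) v)
    (hv0 : v ≠ 0) : x = 0 := by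
  simp only [List.length_append, List.length_cons] at hn
  have hx := hv.mul_eq
  have hy : jm q e t (u.length + 1) * v = x • v := hv _ _ (by simp)
  classical
  by_contra hx0
  obtain ⟨F, hF⟩ := hu (t u.length * v) (hv.of_append.commute_mul fun i hi =>
    (h.commute_t_jm_of_lt hi (by omega)).symm)
  have hL : (jm q e t u.length - algebraMap K A x) * (t u.length * v) = -((q - 1) * x) • v := by
    rw [sub_mul, h.jm_mul_t_mul hq (by omega), hy, ← Algebra.smul_def, mul_smul_comm]
    module
  have hne : -((q - 1) * x) ≠ 0 := neg_ne_zero.2 (mul_ne_zero (sub_ne_zero.2 hq1) hx0)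
  -- a polynomial multiple of `X - x` annihilating `t * v` must have its cofactor vanish at `x`
  have key : ∀ R : K[X], aeval (jm q e t u.length) (R * (X - C x)) * (t u.length * v) = 0 →
      R.eval x = 0 := by
    intro R hR
    rw [map_mul, map_sub, aeval_X, aeval_C, mul_assoc, hL, mul_smul_comm,
      aeval_mul_of_mul_eq_smul hx, smul_smul, smul_eq_zero, mul_eq_zero] at hR
    tauto
  have h1 := key (∏ y ∈ F, (X - C y)) (by rw [mul_comm, map_mul, mul_assoc, hF, mul_zero])
  rw [eval_prod, Finset.prod_eq_zero_iff] at h1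
  obtain ⟨y, hyF, hy0⟩ := h1
  have hxy : x = y := by simpa [sub_eq_zero] using hy0
  subst hxy
  have h2 := key (∏ y ∈ F.erase x, (X - C y)) (by rw [Finset.prod_erase_mul _ _ hyF, hF])
  rw [eval_prod, Finset.prod_eq_zero_iff] at h2
  obtain ⟨z, hzF, hz0⟩ := h2
  have hxz : x = z := by simpa [sub_eq_zero] using hz0
  exact (Finset.mem_erase.1 hzF).1 hxz.symm

theorem isContentSet (h : IsMirabolic q n e t) (hq : q ≠ 0) (hq1 : q ≠ 1) (hq2 : q + 1 ≠ 0)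
    {m : ℕ} (hm : m ≤ n)
    (hs : ∀ a : List K, a.length + 1 < m → HasSimpleSpectrum (jm q e t) a) :
    IsContentSet q fun a => a.length ≤ m ∧ ∃ v ≠ 0, IsWeight (jm q e t) a v := by
  have hadj : ∀ {u w : List K} {x : K} {v : A}, (u ++ x :: x :: w).length ≤ m →
      IsWeight (jm q e t) (u ++ x :: x :: w) v → v ≠ 0 → x = 0 := fun hl hv hv0 =>
    h.eq_zero_of_adjacent hq hq1 (hl.trans hm) (hs _ (by simp at hl; omega)) hv hv0
  refine ⟨?_, ?_, ?_, ?_, ?_⟩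
  · rintro a b ⟨hl, v, hv0, hv⟩
    exact ⟨by simp at hl; omega, v, hv0, hv.of_append⟩
  · rintro x a ⟨hl, v, hv0, hv⟩
    have hx : e * v = x • v := hv.mul_eq (a := [])
    have he := congrArg (· * v) (h.e_mul_e (by simp at hl; omega))
    simp only [mul_assoc, hx, mul_smul_comm, smul_smul] at he
    have h0 : (x * x - x) • v = 0 := by rw [sub_smul, he, sub_self]
    rw [smul_eq_zero, or_iff_left hv0, ← mul_sub_one, mul_eq_zero, sub_eq_zero] at h0
    exact h0
  · rintro u x w ⟨hl, v, hv0, hv⟩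
    exact hadj hl hv hv0
  · rintro u x y w ⟨hl, v, hv0, hv⟩ hx
    have hl' := hl
    simp only [List.length_append, List.length_cons] at hl'
    by_contra hcon
    have hxy : x ≠ y := by
      rintro rfl
      exact hx (hadj (u := u) (w := x :: w) hl hv hv0)
    have hL0 := hv.mul_eq
    have hL1 : jm q e t (u.length + 1) * v = y • v := hv _ _ (by simp)
    have hL2 : jm q e t (u.length + 2) * v = x • v := hv _ _ (by simp)
    have i1 : intertwiner q e t u.length * v = 0 := by
      by_contra hne
      have hw := h.isWeight_swap hq (hl.trans hm) hv
      refine hx (hadj (u := u ++ [y]) (w := w) ?_ (by simpa using hw) hne)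
      simp only [List.length_append, List.length_cons, List.length_nil]; omega
    have i2 : intertwiner q e t (u.length + 1) * v = 0 := by
      by_contra hne
      have hw := h.isWeight_swap hq (u := u ++ [x]) (x := y) (y := x) (w := w)
        (by simp only [List.length_append, List.length_cons, List.length_nil]; omega)
        (by simpa using hv)
      refine hx (hadj (u := u) (w := y :: w) ?_ (by simpa using hw) (by simpa using hne))
      simp only [List.length_append, List.length_cons]; omega
    rw [intertwiner_mul, hL0, hL1, mul_smul_comm, mul_smul_comm] at i1
    rw [intertwiner_mul, hL1, hL2, mul_smul_comm, mul_smul_comm] at i2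
    have hqq : q - 1 ≠ 0 := sub_ne_zero.2 hq1
    have hb := h.braid_mul (i := u.length) (by omega) v
    have hcases : y = q * x ∨ x = q * y := by tauto
    have hy : y ≠ 0 := by
      rintro rfl
      rcases hcases with hc | hc
      · exact mul_ne_zero hq hx hc.symm
      · exact hx (by simpa using hc)
    rcases hcases with rfl | rfl
    · have e1 : t u.length * v = q • v := by
        apply smul_right_injective A (mul_ne_zero hqq hx)
        linear_combination (norm := module) (-1 : K) • i1
      have e2 : t (u.length + 1) * v = (-1 : K) • v := by
        apply smul_right_injective A (mul_ne_zero hqq hx)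
        linear_combination (norm := module) (1 : K) • i2
      simp only [e1, e2, mul_smul_comm, smul_smul] at hb
      have : (q * (q + 1)) • v = 0 := by linear_combination (norm := module) (-1 : K) • hb
      simp [hq, hq2, hv0] at this
    · have e1 : t u.length * v = (-1 : K) • v := by
        apply smul_right_injective A (mul_ne_zero hqq hy)
        linear_combination (norm := module) (1 : K) • i1
      have e2 : t (u.length + 1) * v = q • v := by
        apply smul_right_injective A (mul_ne_zero hqq hy)
        linear_combination (norm := module) (-1 : K) • i2
      simp only [e1, e2, mul_smul_comm, smul_smul] at hb
      have : (q * (q + 1)) • v = 0 := by linear_combination (norm := module) (1 : K) • hb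
      simp [hq, hq2, hv0] at this
  · rintro u x y w ⟨hl, v, hv0, hv⟩ hxy h1 h2
    refine ⟨by simpa using hl, intertwiner q e t u.length * v, ?_,
      h.isWeight_swap hq (hl.trans hm) hv⟩
    exact h.intertwiner_mul_ne_zero hq (hl.trans hm) hv h1 h2 hv0

theorem exists_minimal_annihilator (h : IsMirabolic q n e t) {a : List K} (ha : a.length < n)
    {v : A} (hv : IsWeight (jm q e t) a v) (F : Finset K) :
    aeval (jm q e t a.length) (∏ y ∈ F, (X - C y)) * v = 0 →
    ∃ F' : Finset K, aeval (jm q e t a.length) (∏ y ∈ F', (X - C y)) * v = 0 ∧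
      ∀ y ∈ F', ∃ w ≠ 0, IsWeight (jm q e t) (a ++ [y]) w := by
  classical
  induction F using Finset.strongInduction with
  | H F ih =>
    intro hF
    by_cases hex : ∃ y ∈ F, aeval (jm q e t a.length) (∏ z ∈ F.erase y, (X - C z)) * v = 0
    · obtain ⟨y, hy, hy0⟩ := hex
      exact ih _ (Finset.erase_ssubset hy) hy0
    · refine ⟨F, hF, fun y hy => ⟨_, fun h0 => hex ⟨y, hy, h0⟩, ?_⟩⟩
      refine (hv.commute_mul fun i hi =>
        (commute_aeval (h.commute_jm ha (by omega)) _).symm).concat ?_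
      rw [← sub_eq_zero, Algebra.smul_def, ← sub_mul, ← mul_assoc]
      rw [← Finset.mul_prod_erase _ _ hy, map_mul] at hF
      simpa using hF

theorem aeval_jm_mul_t_mul (h : IsMirabolic q n e t) (hq : q ≠ 0) {i : ℕ} (hi : i + 1 < n)
    (P : K[X]) : ∀ v : A, jm q e t i * v = 0 →
      aeval (jm q e t i) P * (t i * v) = t i * (aeval (jm q e t (i + 1)) P * v) -
        (q - 1) • (aeval (jm q e t (i + 1)) P * v) + ((q - 1) * P.eval 0) • v := by
  induction P using Polynomial.induction_on with
  | C a =>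
    intro v _
    simp only [aeval_C, ← Algebra.smul_def, eval_C, mul_smul_comm]
    module
  | add P Q hP hQ =>
    intro v hv
    simp only [map_add, add_mul, hP v hv, hQ v hv, mul_add, smul_add, eval_add, add_smul]
    abel
  | monomial k a ih =>
    intro v hv
    have hv' : jm q e t i * (jm q e t (i + 1) * v) = 0 := by
      rw [← h.jm_succ_mul_jm_mul hi, hv, mul_zero]
    have e0 : ∀ P : K[X], aeval (jm q e t i) P * (jm q e t (i + 1) * v) =
        P.eval 0 • (jm q e t (i + 1) * v) := fun P =>
      aeval_mul_of_mul_eq_smul (by rw [hv', zero_smul]) P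
    have := ih _ hv'
    have hX : ∀ M w : A, aeval M (C a * X ^ (k + 1)) * w = aeval M (C a * X ^ k) * (M * w) :=
      fun M w => by rw [pow_succ, ← mul_assoc, map_mul (aeval M) _ X, aeval_X, mul_assoc]
    rw [hX, hX, h.jm_mul_t_mul hq hi, mul_sub, mul_smul_comm, this, e0]
    simp only [eval_mul, eval_C, eval_pow, eval_X, zero_pow (Nat.succ_ne_zero k)]
    module

theorem hasSimpleSpectrum (h : IsMirabolic q n e t) (hq : q ≠ 0)
    (hroot : ∀ c : ℤ, q ^ c = 1 → c = 0) (k : ℕ) :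
    ∀ a : List K, a.length = k → k < n → HasSimpleSpectrum (jm q e t) a := by
  classical
  have hq1 : q ≠ 1 := fun h1 => by simpa using hroot 1 (by simpa using h1)
  have hqq : q * q ≠ 1 := fun h1 => by
    simpa using hroot 2 (by rw [zpow_ofNat, sq, h1])
  have hq2 : q + 1 ≠ 0 := fun h1 => hqq (by linear_combination (q - 1) * h1)
  induction k using Nat.strong_induction_on with
  | _ k ih =>
  intro a hak hkn v hv
  by_cases hv0 : v = 0
  · exact ⟨∅, by simp [hv0]⟩
  rcases List.eq_nil_or_concat a with rfl | ⟨b, x, rfl⟩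
  · refine ⟨{0, 1}, ?_⟩
    have he : e * e = e := h.e_mul_e (by omega)
    rw [Finset.prod_pair zero_ne_one]
    simp [jm, mul_sub, he]
  rw [List.concat_eq_append] at *
  simp only [List.length_append, List.length_cons, List.length_nil, zero_add] at hak ⊢
  have hb := ih b.length (by omega) b rfl (by omega)
  have hx := hv.mul_eq
  have hti : ∀ i < b.length, Commute (jm q e t i) (t b.length) := fun i hi =>
    (h.commute_t_jm_of_lt hi (by omega)).symm
  by_cases hx0 : x = 0
  · obtain ⟨F, hF⟩ := hb (t b.length * v) (hv.of_append.commute_mul hti)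
    refine ⟨insert 0 F, ?_⟩
    rw [hx0, zero_smul] at hx
    have h1 := h.aeval_jm_mul_t_mul hq (by omega) (∏ y ∈ insert 0 F, (X - C y)) v hx
    have h2 : aeval (jm q e t b.length) (∏ y ∈ insert 0 F, (X - C y)) * (t b.length * v) = 0 := by
      by_cases h0 : (0 : K) ∈ F
      · rw [Finset.insert_eq_of_mem h0, hF]
      · rw [Finset.prod_insert h0, map_mul, mul_assoc, hF, mul_zero]
    have h3 : eval 0 (∏ y ∈ insert 0 F, (X - C y)) = 0 := by
      rw [eval_prod]
      exact Finset.prod_eq_zero (Finset.mem_insert_self 0 F) (by simp)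
    rw [h2, h3, mul_zero, zero_smul, add_zero, eq_comm, sub_eq_zero] at h1
    generalize aeval (jm q e t (b.length + 1)) (∏ y ∈ insert 0 F, (X - C y)) * v = w at h1
    have h4 := h.t_mul_t_mul (i := b.length) (by omega) w
    rw [h1, mul_smul_comm, h1, left_eq_add, smul_eq_zero] at h4
    tauto
  · set φ := intertwiner q e t b.length with hφ
    have hφv : IsWeight (jm q e t) b (φ * v) := hv.of_append.commute_mul fun i hi =>
      h.commute_jm_intertwiner (by omega) (by omega) (by omega) (by omega)
    obtain ⟨F0, hF0⟩ := hb _ hφv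
    obtain ⟨F, hF, hFS⟩ := h.exists_minimal_annihilator (by omega) hφv F0 hF0
    have hS := h.isContentSet hq hq1 hq2 (m := k) (by omega)
      fun a ha => ih _ (by omega) a rfl (by omega)
    have hxS : (b ++ [x]).length ≤ k ∧ ∃ v ≠ 0, IsWeight (jm q e t) (b ++ [x]) v :=
      ⟨by simp [hak], v, hv0, hv⟩
    have hF1 : q * x ∉ F := fun hm =>
      hS.not_both_extensions hq hroot hx0 hxS ⟨by simp [hak], hFS _ hm⟩
    have hF2 : q⁻¹ * x ∉ F := fun hm =>
      hS.not_both_extensions hq hroot (x := q⁻¹ * x) (mul_ne_zero (inv_ne_zero hq) hx0)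
        ⟨by simp [hak], hFS _ hm⟩ (by rwa [mul_inv_cancel_left₀ hq])
    have hne : q⁻¹ * x ≠ q * x := fun he => hqq (by
      field_simp at he
      rw [← sq, ← he])
    refine ⟨insert (q * x) (insert (q⁻¹ * x) F), ?_⟩
    rw [Finset.prod_insert (by simp [hF1, hne.symm]), Finset.prod_insert hF2]
    have hconj : ∀ P : K[X], aeval (jm q e t (b.length + 1)) P * φ =
        φ * aeval (jm q e t b.length) P := by
      intro P
      induction P using Polynomial.induction_on' with
      | add P Q hP hQ => simp [add_mul, mul_add, hP, hQ]
      | monomial j c =>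
        simp only [aeval_monomial, ← Algebra.smul_def, smul_mul_assoc, mul_smul_comm]
        congr 1
        exact (SemiconjBy.pow_right (h.jm_succ_mul_intertwiner hq (by omega)).symm j).eq.symm
    set P := ∏ y ∈ F, (X - C y)
    set L := jm q e t (b.length + 1)
    have h5 : aeval L P * (φ * (φ * v)) = 0 := by
      rw [← mul_assoc, hconj, mul_assoc, hF, mul_zero]
    have hLL : jm q e t b.length * (L * v) = x • (L * v) := by
      rw [← h.jm_succ_mul_jm_mul (by omega), hx, mul_smul_comm]
    have h6 : φ * (φ * v) = aeval L ((C x - C q * X) * (X - C (q * x))) * v := by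
      have e1 : aeval L (X - C (q * x)) * v = L * v - (q * x) • v := by
        rw [map_sub, aeval_X, aeval_C, sub_mul, ← Algebra.smul_def]
      have e2 : ∀ w, aeval L (C x - C q * X) * w = x • w - q • (L * w) := fun w => by
        rw [map_sub, map_mul, aeval_X, aeval_C, aeval_C, sub_mul, ← Algebra.smul_def, mul_assoc,
          ← Algebra.smul_def]
      rw [hφ, h.intertwiner_mul_intertwiner_mul hq (by omega), map_mul, mul_assoc, e1, e2]
      change (jm q e t b.length - q • L) * ((L - q • jm q e t b.length) * v) = _
      simp only [sub_mul, smul_mul_assoc, hx, mul_sub, mul_smul_comm, hLL]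
      module
    rw [h6, ← mul_assoc, ← map_mul] at h5
    have h7 : (X - C (q * x)) * ((X - C (q⁻¹ * x)) * P) =
        C (-q⁻¹) * (P * ((C x - C q * X) * (X - C (q * x)))) := by
      have : C q⁻¹ * C q = (1 : K[X]) := by rw [← C_mul, inv_mul_cancel₀ hq, C_1]
      simp only [C_mul, C_neg]
      linear_combination (-P * X * (X - C q * C x)) * this
    rw [h7, map_mul, mul_assoc, h5, mul_zero]

theorem t_mul_eq_neg (h : IsMirabolic q n e t) (hq : q ≠ 0) (a : List K) :
    ∀ v, (a ++ [0, 0]).length ≤ n → IsWeight (jm q e t) (a ++ [0, 0]) v → t a.length * v = -v := by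
  induction a using List.reverseRecOn with
  | nil =>
    intro v hn hv
    simp only [List.nil_append, List.length_cons, List.length_nil] at hn ⊢
    have h0 : e * v = 0 := by simpa [jm] using hv 0 0 (by simp)
    have h1 : jm q e t 1 * v = 0 := by simpa using hv 1 0 (by simp)
    have hr := congrArg (· * v) (h.e_rel (by omega))
    simp only [sub_mul, add_mul, mul_sub, mul_assoc, h0, one_mul, mul_one, sub_zero, mul_zero] at hr
    have h2 : t 0 * (e * (t 0 * v)) = 0 := by
      simpa [jm, mul_assoc, hq] using h1
    have h3 : e * (t 0 * v) = 0 := h.eq_of_t_mul_eq hq (i := 0) (by omega) (by rw [h2, mul_zero])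
    rw [h3, mul_zero] at hr
    rw [eq_neg_iff_add_eq_zero, hr, sub_zero]
  | append_singleton b x ih =>
    intro v hn hv
    simp only [List.length_append, List.length_cons, List.length_nil, zero_add] at hn ⊢
    have h1 : jm q e t (b.length + 1) * v = 0 := by
      simpa using hv (b.length + 1) 0 (by simp)
    have h2 : jm q e t (b.length + 2) * v = 0 := by
      simpa using hv (b.length + 2) 0 (by simp)
    have hw : IsWeight (jm q e t) (b ++ [0, 0]) (t (b.length + 1) * (t b.length * v)) := by
      have hb : IsWeight (jm q e t) b v := by
        rw [List.append_assoc] at hv; exact hv.of_append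
      have hb' := (hb.commute_mul (c := t b.length) fun i hi =>
        (h.commute_t_jm_of_lt hi (by omega)).symm).commute_mul (c := t (b.length + 1)) fun i hi =>
          (h.commute_t_jm_of_lt (by omega) (by omega)).symm
      have hb'' := hb'.concat (x := 0) (by
        rw [← (h.commute_t_jm_of_lt (i := b.length) (j := b.length + 1)
          (by omega) (by omega)).left_comm, h.jm_mul_t_mul hq (by omega), h1]
        simp)
      have := hb''.concat (x := 0) (by
        simp only [List.length_append, List.length_cons, List.length_nil, zero_add]
        rw [h.jm_mul_t_mul hq (by omega), ← (h.commute_t_jm_of_gt (i := b.length + 2)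
          (j := b.length) (by omega) (by omega)).left_comm, h2]
        simp)
      simpa using this
    have h3 := ih _ (by simp; omega) hw
    rw [h.braid_mul (by omega)] at h3
    have h4 : t (b.length + 1) * (t b.length * (t (b.length + 1) * v)) =
        t (b.length + 1) * (t b.length * (-v)) := by rw [h3]; simp
    exact h.eq_of_t_mul_eq hq (by omega) (h.eq_of_t_mul_eq hq (by omega) h4)

end IsMirabolic

/-- `v` is a joint eigenvector for right multiplication by `L 0, L 1, …`, with eigenvalues `a`. -/
def IsRowWeight (L : ℕ → A) (a : List K) (v : A) : Prop :=
  ∀ i x, a[i]? = some x → v * L i = x • v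

namespace IsRowWeight

variable {L : ℕ → A} {a b : List K} {x : K} {v : A}

theorem of_append (h : IsRowWeight L (a ++ b) v) : IsRowWeight L a v := fun i x hx => by
  obtain ⟨hi, -⟩ := List.getElem?_eq_some_iff.1 hx
  exact h i x (by rw [List.getElem?_append_left hi, hx])

theorem mul_eq (h : IsRowWeight L (a ++ x :: b) v) : v * L a.length = x • v :=
  h _ _ (by simp)

theorem concat (h : IsRowWeight L a v) (hx : v * L a.length = x • v) :
    IsRowWeight L (a ++ [x]) v := by
  intro i y hy
  rcases lt_trichotomy i a.length with hi | rfl | hi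
  · exact h i y (by rwa [List.getElem?_append_left hi] at hy)
  · have : x = y := by simpa using hy
    rw [← this, hx]
  · rw [List.getElem?_eq_none (by simp; omega)] at hy
    simp at hy

theorem mul_commute (h : IsRowWeight L a v) {c : A} (hc : ∀ i < a.length, Commute (L i) c) :
    IsRowWeight L a (v * c) := fun i x hx => by
  obtain ⟨hi, -⟩ := List.getElem?_eq_some_iff.1 hx
  rw [mul_assoc, ← (hc i hi).eq, ← mul_assoc, h i x hx, smul_mul_assoc]

theorem mul_left (h : IsRowWeight L a v) (w : A) : IsRowWeight L a (w * v) := fun i x hx => by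
  rw [mul_assoc, h i x hx, mul_smul_comm]

theorem mul_eq_zero (h : IsRowWeight L b v) {w : A} (hw : IsWeight L a w)
    (hl : b.length = a.length) (hne : b ≠ a) : v * w = 0 := by
  by_contra h0
  refine hne (List.ext_getElem hl fun i hi hi' => ?_)
  have h1 := congrArg (· * w) (h i _ (List.getElem?_eq_getElem hi))
  simp only [mul_assoc, hw i _ (List.getElem?_eq_getElem hi'), mul_smul_comm,
    smul_mul_assoc] at h1
  exact (smul_left_injective K h0 h1).symm

end IsRowWeight

/-- The generators `e, t 0, t 1, …` listed in one sequence. -/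
def gen (e : A) (t : ℕ → A) : ℕ → A
  | 0 => e
  | k + 1 => t k

variable (K) in
/-- The subalgebra generated by the first `k` generators. -/
def level (e : A) (t : ℕ → A) (k : ℕ) : Subalgebra K A :=
  Algebra.adjoin K (gen e t '' Set.Iio k)

theorem gen_mem_level {e : A} {t : ℕ → A} {j k : ℕ} (hj : j < k) : gen e t j ∈ level K e t k :=
  Algebra.subset_adjoin ⟨j, hj, rfl⟩

theorem level_mono {e : A} {t : ℕ → A} {j k : ℕ} (hj : j ≤ k) : level K e t j ≤ level K e t k :=
  Algebra.adjoin_mono (Set.image_mono (Set.Iio_subset_Iio hj))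

theorem jm_mem_level {q : K} {e : A} {t : ℕ → A} {j k : ℕ} (hj : j < k) :
    jm q e t j ∈ level K e t k := by
  induction j with
  | zero => exact gen_mem_level hj
  | succ j ih =>
    have ht : t j ∈ level K e t k := gen_mem_level hj
    exact (level K e t k).smul_mem (mul_mem (mul_mem ht (ih (by omega))) ht) _

theorem commute_of_mem_level {e : A} {t : ℕ → A} {k : ℕ} {c x : A}
    (hc : ∀ j < k, Commute c (gen e t j)) (hx : x ∈ level K e t k) : Commute c x := by
  induction hx using Algebra.adjoin_induction with
  | mem x hx =>
    obtain ⟨j, hj, rfl⟩ := hx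
    exact hc j hj
  | algebraMap r => exact Algebra.commute_algebraMap_right r c
  | add x y _ _ hx hy => exact hx.add_right hy
  | mul x y _ _ hx hy => exact hx.mul_right hy

/-- The joint eigenvectors of both left and right multiplication by the first `k`
Jucys–Murphy elements, inside the subalgebra generated by the first `k` generators. -/
def weightVectors (q : K) (e : A) (t : ℕ → A) (k : ℕ) : Set A :=
  {x | x ∈ level K e t k ∧ ∃ a : List K, a.length = k ∧ IsWeight (jm q e t) a x ∧
    IsRowWeight (jm q e t) a x}

namespace IsMirabolic

open Polynomial

variable {q : K} {n : ℕ} {e : A} {t : ℕ → A}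

theorem commute_t_of_mem_level (h : IsMirabolic q n e t) {k : ℕ} (hk : k + 1 < n) {x : A}
    (hx : x ∈ level K e t k) : Commute (t k) x :=
  commute_of_mem_level (fun j hj => by
    match j with
    | 0 => exact (h.e_comm k hj hk).symm
    | j + 1 => exact (h.comm j k hj hk).symm) hx

theorem commute_jm_of_mem_level (h : IsMirabolic q n e t) {k : ℕ} (hk : k < n) {x : A}
    (hx : x ∈ level K e t k) : Commute (jm q e t k) x :=
  commute_of_mem_level (fun j hj => by
    match j with
    | 0 => exact h.commute_jm hk (by omega : 0 < n)
    | j + 1 => exact (h.commute_t_jm_of_gt hj hk).symm) hx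

theorem one_mem_span_weightVectors (h : IsMirabolic q n e t) (hq : q ≠ 0)
    (hroot : ∀ c : ℤ, q ^ c = 1 → c = 0) {k : ℕ} (hk : k ≤ n) :
    1 ∈ Submodule.span K (weightVectors q e t k) := by
  classical
  induction k with
  | zero =>
    exact Submodule.subset_span
      ⟨one_mem _, [], rfl, by simp [IsWeight], by simp [IsRowWeight]⟩
  | succ k ih =>
    refine Submodule.span_le.2 ?_ (ih (by omega))
    rintro x ⟨hxl, a, rfl, hxa, hxr⟩
    obtain ⟨F, hF⟩ := h.hasSimpleSpectrum hq hroot _ a rfl hk x hxa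
    rw [SetLike.mem_coe]
    set L := jm q e t a.length
    rcases F.eq_empty_or_nonempty with rfl | hne
    · have : x = 0 := by simpa using hF
      rw [this]
      exact zero_mem _
    have hsum : x = ∑ y ∈ F, aeval L (Lagrange.basis F id y) * x := by
      rw [← Finset.sum_mul, ← map_sum, Lagrange.sum_basis Function.injective_id.injOn hne, map_one,
        one_mul]
    rw [hsum]
    refine sum_mem fun y hy => Submodule.subset_span ?_
    have hLx : Commute L x := h.commute_jm_of_mem_level hk hxl
    have hLL : ∀ P : K[X], Commute (aeval L P) L := commute_aeval (Commute.refl L)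
    have hLP : ∀ (P : K[X]), ∀ i < a.length, Commute (jm q e t i) (aeval L P) := fun P i hi =>
      (commute_aeval (h.commute_jm hk (by omega)) P).symm
    have hcy : L * (aeval L (Lagrange.basis F id y) * x) =
        y • (aeval L (Lagrange.basis F id y) * x) := by
      have h1 : (X - C y) * Lagrange.basis F id y =
          C (Lagrange.nodalWeight F id y) * ∏ y ∈ F, (X - C y) := by
        rw [Lagrange.basis_eq_prod_sub_inv_mul_nodal_div hy,
          ← Lagrange.nodal_erase_eq_nodal_div hy, mul_left_comm]
        congr 1
        rw [← Finset.mul_prod_erase _ _ hy]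
        rfl
      rw [← sub_eq_zero, Algebra.smul_def, ← sub_mul, ← mul_assoc]
      have h2 := congrArg (fun P => aeval L P * x) h1
      simp only [map_mul, mul_assoc] at h2
      rw [hF] at h2
      simpa [mul_assoc] using h2
    refine ⟨mul_mem (Algebra.adjoin_le (Set.singleton_subset_iff.2 (jm_mem_level (by omega)))
      (aeval_mem_adjoin_singleton _ _)) (level_mono (by omega) hxl), a ++ [y], by simp, (hxa.commute_mul (hLP _)).concat hcy, ?_⟩
    have hP := (commute_aeval hLx (Lagrange.basis F id y)).eq
    refine IsRowWeight.concat ?_ ?_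
    · rw [hP]
      exact hxr.mul_commute (hLP _)
    · rw [← ((hLL _).symm.mul_right hLx).eq, hcy]

theorem mem_of_mem_level {e : A} {t : ℕ → A} {k : ℕ} {N : Submodule K A} (h1 : 1 ∈ N)
    (hN : ∀ j < k, ∀ x ∈ N, gen e t j * x ∈ N) {y : A} (hy : y ∈ level K e t k) : y ∈ N := by
  have key : ∀ x ∈ N, y * x ∈ N := by
    induction hy using Algebra.adjoin_induction with
    | mem y hy =>
      obtain ⟨j, hj, rfl⟩ := hy
      exact hN j hj
    | algebraMap r =>
      intro x hx
      rw [← Algebra.smul_def]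
      exact N.smul_mem r hx
    | add y z _ _ hy hz =>
      intro x hx
      rw [add_mul]
      exact add_mem (hy x hx) (hz x hx)
    | mul y z _ _ hy hz =>
      intro x hx
      rw [mul_assoc]
      exact hy _ (hz x hx)
  simpa using key 1 h1

/-- Every element generated by the first `k + 1` generators involves the last of them, up to
the next Jucys–Murphy element, at most once. -/
theorem mem_span_of_mem_level (h : IsMirabolic q n e t) (hq : q ≠ 0) {k : ℕ} (hk : k < n) :
    ∀ y ∈ level K e t (k + 1), y ∈ Submodule.span K {x | ∃ r ∈ level K e t k,
      ∃ s ∈ level K e t k, x = r ∨ x = r * (gen e t k * s) ∨ x = r * jm q e t k} := by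
  intro y hy
  induction k generalizing y with
  | zero =>
    set N := Submodule.span K {x | ∃ r ∈ level K e t 0,
      ∃ s ∈ level K e t 0, x = r ∨ x = r * (gen e t 0 * s) ∨ x = r * jm q e t 0} with hN
    have hN1 : 1 ∈ N := Submodule.subset_span ⟨1, one_mem _, 1, one_mem _, .inl rfl⟩
    refine mem_of_mem_level hN1 ?_ hy
    intro j hj x hx
    obtain rfl : j = 0 := by omega
    change x ∈ Submodule.comap (LinearMap.mulLeft K (gen e t 0)) N
    refine Submodule.span_le.2 ?_ hx
    rintro x ⟨r, hr, s, hs, hx⟩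
    have her : e * r = r * e := (h.commute_jm_of_mem_level hk hr).eq
    have hee : e * e = e := h.e_mul_e hk
    change gen e t 0 * x ∈ N
    apply Submodule.subset_span
    rcases hx with rfl | rfl | rfl
    · exact ⟨x, hr, s, hs, .inr (.inr her)⟩
    · exact ⟨r, hr, s, hs, .inr (.inl
        (by simp only [gen]; rw [← mul_assoc, her, mul_assoc, ← mul_assoc e, hee]))⟩
    · exact ⟨r, hr, s, hs, .inr (.inr
        (by simp only [gen, jm]; rw [← mul_assoc, her, mul_assoc, hee]))⟩
  | succ k ih =>
    set N := Submodule.span K {x | ∃ r ∈ level K e t (k + 1),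
      ∃ s ∈ level K e t (k + 1),
        x = r ∨ x = r * (gen e t (k + 1) * s) ∨ x = r * jm q e t (k + 1)} with hN
    have hN1 : ∀ r ∈ level K e t (k + 1), r ∈ N := fun r hr =>
      Submodule.subset_span ⟨r, hr, r, hr, .inl rfl⟩
    have hN2 : ∀ r ∈ level K e t (k + 1), ∀ s ∈ level K e t (k + 1), r * (t k * s) ∈ N :=
      fun r hr s hs => Submodule.subset_span ⟨r, hr, s, hs, .inr (.inl rfl)⟩
    have hN3 : ∀ r ∈ level K e t (k + 1), r * jm q e t (k + 1) ∈ N := fun r hr =>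
      Submodule.subset_span ⟨r, hr, r, hr, .inr (.inr rfl)⟩
    have hsub : level K e t k ≤ level K e t (k + 1) := level_mono (by omega)
    have hrts : ∀ s ∈ level K e t (k + 1), ∀ r ∈ level K e t (k + 1),
        t k * (r * (t k * s)) ∈ N := by
      intro s hs r hr
      change r ∈ Submodule.comap (LinearMap.mulLeft K (t k) ∘ₗ LinearMap.mulRight K (t k * s)) N
      refine Submodule.span_le.2 ?_ (ih (by omega) r hr)
      rintro x ⟨r, hr, s', hs', hx⟩
      change t k * (x * (t k * s)) ∈ N
      have htr : ∀ v, t k * (r * v) = r * (t k * v) := (h.commute_t_of_mem_level hk hr).left_comm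
      have hts : ∀ v, s' * (t k * v) = t k * (s' * v) :=
        (h.commute_t_of_mem_level hk hs').symm.left_comm
      have hjs : jm q e t (k + 1) * s = s * jm q e t (k + 1) :=
        (h.commute_jm_of_mem_level hk hs).eq
      have hL : ∀ r ∈ level K e t k, r * (t k * (jm q e t k * (t k * s))) ∈ N := by
        intro r hr
        have h1 : t k * (jm q e t k * (t k * s)) = q • (s * jm q e t (k + 1)) := by
          rw [← hjs, jm, smul_mul_assoc, smul_inv_smul₀ hq]
          simp only [mul_assoc]
        rw [h1, mul_smul_comm, ← mul_assoc]
        exact N.smul_mem _ (hN3 _ (mul_mem (hsub hr) hs))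
      rcases hx with rfl | rfl | rfl
      · rw [htr, h.t_mul_t_mul hk, mul_add, mul_smul_comm, mul_smul_comm]
        exact add_mem (N.smul_mem _ (hN2 _ (hsub hr) _ hs))
          (N.smul_mem _ (hN1 _ (mul_mem (hsub hr) hs)))
      · match k with
        | 0 =>
          have hs0 : e * s' = s' * e := (h.commute_jm_of_mem_level (by omega) hs').eq
          have h2 := hL _ (mul_mem hr hs')
          simp only [gen, mul_assoc]
          rw [htr, ← mul_assoc e, hs0]
          simp only [jm, mul_assoc] at h2
          rwa [hts, ← mul_assoc s'] at h2
        | k + 1 =>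
          have hg : t k ∈ level K e t (k + 2) := gen_mem_level (j := k + 1) (by omega)
          simp only [gen, mul_assoc]
          rw [htr, hts, ← h.braid_mul hk, ← mul_assoc]
          exact hN2 _ (mul_mem (hsub hr) hg) _ (mul_mem hg (mul_mem (hsub hs') hs))
      · rw [mul_assoc, htr]
        exact hL r hr
    refine mem_of_mem_level (hN1 1 (one_mem _)) ?_ hy
    intro j hj x hx
    change x ∈ Submodule.comap (LinearMap.mulLeft K (gen e t j)) N
    refine Submodule.span_le.2 ?_ hx
    rintro x ⟨r, hr, s, hs, hx⟩
    change gen e t j * x ∈ N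
    rcases Nat.lt_succ_iff_lt_or_eq.1 hj with hj | rfl
    · have hgr := mul_mem (gen_mem_level hj) hr
      rcases hx with rfl | rfl | rfl
      · exact hN1 _ hgr
      · rw [← mul_assoc]
        exact hN2 _ hgr _ hs
      · rw [← mul_assoc]
        exact hN3 _ hgr
    · rcases hx with rfl | rfl | rfl
      · simpa [gen] using hN2 1 (one_mem _) _ hr
      · exact hrts _ hs _ hr
      · have hL : jm q e t (k + 1) * r = r * jm q e t (k + 1) :=
          (h.commute_jm_of_mem_level hk hr).eq
        change t k * (r * jm q e t (k + 1)) ∈ N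
        rw [← hL, ← mul_assoc, h.t_mul_jm_succ hq hk, add_mul, smul_mul_assoc, hL, mul_assoc]
        exact add_mem (N.smul_mem _ (hN3 _ hr)) (hN2 _ (jm_mem_level (by omega)) _ hr)

/-- Between vectors of given weights, a generator acts as a scalar. -/
theorem exists_mul_t_mul_eq (h : IsMirabolic q n e t) (hq : q ≠ 0)
    (hroot : ∀ c : ℤ, q ^ c = 1 → c = 0) {m : ℕ} (hm : m + 1 < n) {c d : List K}
    (hc : c.length = m + 1) (hd : d.length = m + 1) (x : K) :
    ∃ κ : K, ∀ U V : A, IsRowWeight (jm q e t) (c ++ [x]) U → IsWeight (jm q e t) (d ++ [x]) V →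
      U * (t m * V) = κ • (U * V) := by
  have hq1 : q ≠ 1 := fun h1 => by simpa using hroot 1 (by simpa using h1)
  obtain rfl | ⟨c, y, rfl⟩ := List.eq_nil_or_concat c
  · simp at hc
  obtain rfl | ⟨d, z, rfl⟩ := List.eq_nil_or_concat d
  · simp at hd
  simp only [List.concat_eq_append, List.append_assoc, List.cons_append, List.nil_append,
    List.length_append, List.length_cons, List.length_nil, zero_add, add_left_inj] at hc hd ⊢
  by_cases hcd : c = d
  swap
  · refine ⟨0, fun U V hU hV => ?_⟩
    rw [zero_smul]
    refine hU.of_append.mul_eq_zero (hV.of_append.commute_mul fun i hi => ?_) (hc.trans hd.symm) hcd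
    exact (h.commute_t_jm_of_lt (by omega) hm).symm
  subst hcd hc
  by_cases hyz : y = z
  swap
  · refine ⟨0, fun U V hU hV => ?_⟩
    have h1 := h.jm_mul_t_mul hq hm V
    have h2 := h.jm_succ_mul_t_mul hq hm V
    have hU0 := hU.mul_eq
    have hU1 : U * jm q e t (c.length + 1) = x • U := hU _ _ (by simp)
    have hV0 := hV.mul_eq
    have hV1 : jm q e t (c.length + 1) * V = x • V := hV _ _ (by simp)
    rw [hV1] at h1 h2
    rw [hV0] at h2
    replace h1 := congrArg (U * ·) h1
    replace h2 := congrArg (U * ·) h2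
    simp only [← mul_assoc, hU0, hU1] at h1 h2
    simp only [mul_assoc, mul_sub, mul_add, mul_smul_comm, smul_mul_assoc] at h1 h2
    have h3 : (y - z) • (U * (t c.length * V)) = 0 := by
      linear_combination (norm := module) (1 : K) • h1 + (1 : K) • h2
    rw [zero_smul]
    exact (smul_eq_zero.1 h3).resolve_left (sub_ne_zero.2 hyz)
  subst hyz
  by_cases hxy : x = y
  · subst hxy
    by_cases hx : x = 0
    · subst hx
      refine ⟨-1, fun U V _ hV => ?_⟩
      rw [h.t_mul_eq_neg hq c V (by simp; omega) hV, mul_neg, neg_one_smul]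
    · refine ⟨0, fun U V _ hV => ?_⟩
      have hV0 : V = 0 := by
        by_contra hV0
        exact hx (h.eq_zero_of_adjacent hq hq1 (by simp; omega)
          (h.hasSimpleSpectrum hq hroot _ c rfl (by omega)) hV hV0)
      simp [hV0]
  · refine ⟨(x - y)⁻¹ * ((q - 1) * x), fun U V hU hV => ?_⟩
    have h2 := h.jm_succ_mul_t_mul hq hm V
    have hU1 : U * jm q e t (c.length + 1) = x • U := hU _ _ (by simp)
    have hV1 : jm q e t (c.length + 1) * V = x • V := hV _ _ (by simp)
    rw [hV1, hV.mul_eq] at h2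
    replace h2 := congrArg (U * ·) h2
    simp only [← mul_assoc, hU1] at h2
    simp only [mul_assoc, mul_add, mul_smul_comm, smul_mul_assoc] at h2
    have h3 : (x - y) • (U * (t c.length * V)) = ((q - 1) * x) • (U * V) := by
      linear_combination (norm := module) (1 : K) • h2
    rw [mul_smul, ← h3, inv_smul_smul₀ (sub_ne_zero.2 hxy)]

/-- Weight multiplicities are at most one: on the pairing of row and column vectors of the
same weight, every element acts as a scalar. -/
theorem exists_mul_mul_eq (h : IsMirabolic q n e t) (hq : q ≠ 0)
    (hroot : ∀ c : ℤ, q ^ c = 1 → c = 0) (k : ℕ) (hk : k ≤ n) :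
    ∀ a : List K, a.length = k → ∀ y ∈ level K e t k, ∃ c : K, ∀ u v : A,
      IsRowWeight (jm q e t) a u → IsWeight (jm q e t) a v → u * (y * v) = c • (u * v) := by
  -- the elements acting as scalars form a submodule
  have hsub : ∀ a : List K, ∃ N : Submodule K A, ∀ y, y ∈ N ↔ ∃ c : K, ∀ u v : A,
      IsRowWeight (jm q e t) a u → IsWeight (jm q e t) a v → u * (y * v) = c • (u * v) := by
    intro a
    refine ⟨⟨⟨⟨{y | ∃ c : K, ∀ u v : A, IsRowWeight (jm q e t) a u → IsWeight (jm q e t) a v →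
      u * (y * v) = c • (u * v)}, ?_⟩, ?_⟩, ?_⟩, fun y => Iff.rfl⟩
    · rintro y z ⟨c, hc⟩ ⟨d, hd⟩
      exact ⟨c + d, fun u v hu hv => by rw [add_mul, mul_add, hc u v hu hv, hd u v hu hv, add_smul]⟩
    · exact ⟨0, by simp⟩
    · rintro r y ⟨c, hc⟩
      exact ⟨r * c, fun u v hu hv => by rw [smul_mul_assoc, mul_smul_comm, hc u v hu hv, mul_smul]⟩
  induction k with
  | zero =>
    intro a ha y hy
    obtain ⟨N, hN⟩ := hsub a
    exact (hN y).1 (mem_of_mem_level ((hN 1).2 ⟨1, by simp⟩) (by simp) hy)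
  | succ k ih =>
    intro a ha y hy
    obtain ⟨N, hN⟩ := hsub a
    obtain rfl | ⟨b, x, rfl⟩ := List.eq_nil_or_concat a
    · simp at ha
    simp only [List.concat_eq_append, List.length_append, List.length_cons, List.length_nil,
      zero_add, add_left_inj] at ha hN ⊢
    subst ha
    rw [← hN]
    refine Submodule.span_le.2 ?_ (h.mem_span_of_mem_level hq hk y hy)
    have hlow : ∀ r ∈ level K e t b.length, r ∈ N := fun r hr => by
      obtain ⟨c, hc⟩ := ih (by omega) b rfl r hr
      exact (hN r).2 ⟨c, fun u v hu hv => hc u v hu.of_append hv.of_append⟩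
    have hjm : ∀ r ∈ level K e t b.length, r * jm q e t b.length ∈ N := fun r hr => by
      obtain ⟨c, hc⟩ := ih (by omega) b rfl r hr
      refine (hN _).2 ⟨x * c, fun u v hu hv => ?_⟩
      rw [mul_assoc r, hv.mul_eq, mul_smul_comm, mul_smul_comm, hc u v hu.of_append hv.of_append,
        mul_smul]
    rintro _ ⟨r, hr, s, hs, rfl | rfl | rfl⟩
    · exact hlow _ hr
    swap
    · exact hjm r hr
    rcases hb : b.length with - | m
    · have hes : jm q e t b.length * s = s * jm q e t b.length :=
        (h.commute_jm_of_mem_level hk hs).eq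
      have := hjm _ (mul_mem hr hs)
      rw [mul_assoc, ← hes, hb] at this
      exact this
    have hone := h.one_mem_span_weightVectors hq hroot (k := b.length) (by omega)
    have key : ∀ E ∈ Submodule.span K (weightVectors q e t b.length),
        ∀ F ∈ Submodule.span K (weightVectors q e t b.length), r * E * (t m * (F * s)) ∈ N := by
      intro E hE F hF
      induction hE, hF using Submodule.span_induction₂ with
      | zero_left => simp
      | zero_right => simp
      | add_left x y z _ _ _ h1 h2 =>
        rw [mul_add, add_mul]; exact add_mem h1 h2
      | add_right x y z _ _ _ h1 h2 =>
        rw [add_mul, mul_add, mul_add]; exact add_mem h1 h2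
      | smul_left c x y _ _ h1 =>
        rw [mul_smul_comm, smul_mul_assoc]; exact N.smul_mem c h1
      | smul_right c x y _ _ h1 =>
        rw [smul_mul_assoc, mul_smul_comm, mul_smul_comm]; exact N.smul_mem c h1
      | mem_mem E F hE hF =>
        obtain ⟨hEl, c, hc, -, hEc⟩ := hE
        obtain ⟨hFl, d, hd, hFd, -⟩ := hF
        obtain ⟨κ, hκ⟩ := h.exists_mul_t_mul_eq hq hroot (by omega) (hc.trans hb) (hd.trans hb) x
        obtain ⟨c', hc'⟩ := ih (by omega) b rfl _ (mul_mem (mul_mem hr hEl) (mul_mem hFl hs))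
        refine (hN _).2 ⟨κ * c', fun u v hu hv => ?_⟩
        have h1 : IsRowWeight (jm q e t) (c ++ [x]) (u * (r * E)) := by
          rw [← mul_assoc]
          refine (hEc.mul_left _).concat ?_
          rw [mul_assoc, mul_assoc, hc, ← mul_assoc r,
            ← (h.commute_jm_of_mem_level hk (mul_mem hr hEl)).eq, ← mul_assoc, hu.mul_eq,
            smul_mul_assoc, mul_assoc]
        have h2 : IsWeight (jm q e t) (d ++ [x]) (F * s * v) := by
          rw [mul_assoc]
          refine (hFd.mul_right _).concat ?_
          rw [← mul_assoc, hd, ← mul_assoc, mul_assoc _ F,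
            (h.commute_jm_of_mem_level hk (mul_mem hFl hs)).eq, mul_assoc, hv.mul_eq,
            mul_smul_comm, mul_assoc]
        have h3 := hκ _ _ h1 h2
        have h4 := hc' u v hu.of_append hv.of_append
        rw [mul_smul, ← h4]
        simpa only [mul_assoc] using h3
    have := key 1 hone 1 hone
    rw [mul_one, one_mul] at this
    exact this

theorem exists_center_scalar (h : IsMirabolic q n e t) (hq : q ≠ 0)
    (hroot : ∀ c : ℤ, q ^ c = 1 → c = 0) {z : A} (hz : ∀ y, Commute z y)
    (hzn : z ∈ level K e t n) {a : List K} (ha : a.length = n) :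
    ∃ c : K, ∀ v, IsWeight (jm q e t) a v → z * v = c • v := by
  obtain ⟨c, hc⟩ := h.exists_mul_mul_eq hq hroot n le_rfl a ha z hzn
  refine ⟨c, fun v hv => ?_⟩
  have key : ∀ E ∈ Submodule.span K (weightVectors q e t n), E * (z * v) = c • (E * v) := by
    intro E hE
    induction hE using Submodule.span_induction with
    | zero => simp
    | add x y _ _ hx hy => rw [add_mul, hx, hy, add_mul, smul_add]
    | smul r x _ hx => rw [smul_mul_assoc, hx, smul_mul_assoc, smul_comm]
    | mem E hE =>
      obtain ⟨-, b, hb, -, hEb⟩ := hE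
      by_cases hba : b = a
      · exact hc E v (hba ▸ hEb) hv
      · rw [← (hz E).left_comm, hEb.mul_eq_zero hv (hb.trans ha.symm) hba, mul_zero, smul_zero]
  simpa using key 1 (h.one_mem_span_weightVectors hq hroot le_rfl)

theorem exists_center_scalar_multiset (h : IsMirabolic q n e t) (hq : q ≠ 0)
    (hroot : ∀ c : ℤ, q ^ c = 1 → c = 0) {z : A} (hz : ∀ y, Commute z y)
    (hzn : z ∈ level K e t n) :
    ∃ f : Multiset K → K, ∀ a : List K, a.length = n → ∀ v, IsWeight (jm q e t) a v →
      z * v = f a • v := by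
  have hq1 : q ≠ 1 := fun h1 => by simpa using hroot 1 (by simpa using h1)
  have hq2 : q + 1 ≠ 0 := fun h1 => by
    have : q ^ (2 : ℤ) = 1 := by rw [zpow_ofNat]; linear_combination (q - 1) * h1
    simpa using hroot 2 this
  have hS := h.isContentSet hq hq1 hq2 le_rfl fun a ha =>
    h.hasSimpleSpectrum hq hroot _ a rfl (by omega)
  have key : ∀ m : Multiset K, ∃ c : K, ∀ a : List K, (a : Multiset K) = m → a.length = n →
      ∀ v, IsWeight (jm q e t) a v → z * v = c • v := by
    intro m
    by_cases hm : ∃ a : List K, (a : Multiset K) = m ∧ a.length = n ∧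
      ∃ v ≠ 0, IsWeight (jm q e t) a v
    · obtain ⟨a, rfl, ha, v, hv0, hv⟩ := hm
      obtain ⟨c, hc⟩ := h.exists_center_scalar hq hroot hz hzn ha
      refine ⟨c, fun b hba hb w hw => ?_⟩
      by_cases hw0 : w = 0
      · simp [hw0]
      have hswap : SwapClosed q fun b => b.length ≤ n ∧
          ∃ v ≠ 0, IsWeight (jm q e t) b v ∧ z * v = c • v := by
        rintro u x y w ⟨hl, v, hv0, hv, hzv⟩ - h1 h2
        refine ⟨by simpa using hl, _, h.intertwiner_mul_ne_zero hq hl hv h1 h2 hv0,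
          h.isWeight_swap hq hl hv, ?_⟩
        rw [(hz _).left_comm, hzv, mul_smul_comm]
      obtain ⟨-, v', hv0', hv', hzv'⟩ := hS.of_perm hq hroot b _ a hswap
        (fun c hc => ⟨hc.1, hc.2.imp fun v hv => ⟨hv.1, hv.2.1⟩⟩) ⟨ha.le, v, hv0, hv, hc v hv⟩
        ⟨hb.le, w, hw0, hw⟩ (Multiset.coe_eq_coe.1 hba.symm)
      obtain ⟨d, hd⟩ := h.exists_center_scalar hq hroot hz hzn hb
      rw [hd v' hv'] at hzv'
      rw [hd w hw, smul_left_injective K hv0' hzv']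
    · refine ⟨0, fun a ha hl v hv => ?_⟩
      by_cases hv0 : v = 0
      · simp [hv0]
      · exact absurd ⟨a, ha, hl, v, hv0, hv⟩ hm
  choose f hf using key
  exact ⟨f, fun a => hf _ a rfl⟩

end IsMirabolic

open Polynomial in
theorem exists_isSymmetric_eval_eq [Infinite K] (n : ℕ) (M : Finset (Multiset K))
    (f : Multiset K → K) : ∃ p : MvPolynomial (Fin n) K, p.IsSymmetric ∧
      ∀ x : Fin n → K, (List.ofFn x : Multiset K) ∈ M →
        MvPolynomial.eval x p = f (List.ofFn x) := by
  classical
  set P : Multiset K → K[X] := fun m => (m.map fun a => X - C a).prod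
  have hP : Function.Injective P := fun m m' hm => by
    simpa [P, roots_multiset_prod_X_sub_C] using congrArg roots hm
  obtain ⟨τ, hτ⟩ : ∃ τ : K, (∏ m ∈ M.offDiag, (P m.1 - P m.2)).eval τ ≠ 0 := by
    by_contra! hall
    refine Finset.prod_ne_zero_iff.2 ?_ (Polynomial.funext fun r => (hall r).trans eval_zero.symm)
    intro m hm
    exact sub_ne_zero.2 (hP.ne (Finset.mem_offDiag.1 hm).2.2)
  have hinj : Set.InjOn (fun m => (P m).eval τ) M := by
    intro m hm m' hm' heq
    by_contra hne
    rw [eval_prod, Finset.prod_ne_zero_iff] at hτ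
    exact hτ (m, m') (Finset.mem_offDiag.2 ⟨hm, hm', hne⟩) (by simpa [sub_eq_zero] using heq)
  refine ⟨aeval (∏ i, (MvPolynomial.C τ - MvPolynomial.X i))
    (Lagrange.interpolate M (fun m => (P m).eval τ) f), fun σ => ?_, fun x hx => ?_⟩
  · rw [← aeval_algHom_apply, map_prod]
    congr 2
    simpa using Equiv.prod_comp σ fun i => (MvPolynomial.C τ - MvPolynomial.X i :
      MvPolynomial (Fin n) K)
  · rw [← Lagrange.eval_interpolate_at_node f hinj hx, ← MvPolynomial.coe_aeval_eq_eval]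
    change (MvPolynomial.aeval x) _ = _
    rw [← aeval_algHom_apply, coe_aeval_eq_eval]
    congr 1
    simp [P, map_prod, List.prod_ofFn, eval_prod, List.map_ofFn]

/-- Evaluation of a polynomial at a sequence of elements, multiplied in order. -/
def orderedEval (L : ℕ → A) (n : ℕ) (p : MvPolynomial (Fin n) K) : A :=
  ∑ s ∈ p.support, MvPolynomial.coeff s p • ((List.finRange n).map fun i : Fin n => L i ^ s i).prod

theorem IsWeight.orderedEval_mul {L : ℕ → A} {n : ℕ} {x : Fin n → K} {v : A}
    (hv : IsWeight L (List.ofFn x) v) (p : MvPolynomial (Fin n) K) :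
    orderedEval L n p * v = MvPolynomial.eval x p • v := by
  rw [orderedEval, MvPolynomial.eval_eq', Finset.sum_mul, Finset.sum_smul]
  refine Finset.sum_congr rfl fun s _ => ?_
  rw [smul_mul_assoc, mul_smul, Fin.prod_univ_def]
  congr 1
  induction List.finRange n with
  | nil => simp
  | cons i l ih =>
    have hi : L i * v = x i • v := hv i (x i) (by simp)
    have hpow : ∀ k : ℕ, L i ^ k * v = x i ^ k • v := fun k => by
      induction k with
      | zero => simp
      | succ k ih => rw [pow_succ, mul_assoc, hi, mul_smul_comm, ih, smul_smul, pow_succ']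
    rw [List.map_cons, List.prod_cons, mul_assoc, ih, mul_smul_comm, hpow, smul_smul, mul_comm,
      List.map_cons, List.prod_cons]

theorem IsRowWeight.mul_orderedEval {L : ℕ → A} {n : ℕ} {x : Fin n → K} {v : A}
    (hv : IsRowWeight L (List.ofFn x) v) (p : MvPolynomial (Fin n) K) :
    v * orderedEval L n p = MvPolynomial.eval x p • v := by
  rw [orderedEval, MvPolynomial.eval_eq', Finset.mul_sum, Finset.sum_smul]
  refine Finset.sum_congr rfl fun s _ => ?_
  rw [mul_smul_comm, mul_smul, Fin.prod_univ_def]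
  congr 1
  induction List.finRange n with
  | nil => simp
  | cons i l ih =>
    have hi : v * L i = x i • v := hv i (x i) (by simp)
    have hpow : ∀ k : ℕ, v * L i ^ k = x i ^ k • v := fun k => by
      induction k with
      | zero => simp
      | succ k ih => rw [pow_succ, ← mul_assoc, ih, smul_mul_assoc, hi, smul_smul, pow_succ]
    rw [List.map_cons, List.prod_cons, ← mul_assoc, hpow, smul_mul_assoc, ih, smul_smul,
      List.map_cons, List.prod_cons]

namespace IsMirabolic

variable {q : K} {n : ℕ} {e : A} {t : ℕ → A}

theorem exists_orderedEval_eq [Infinite K] (h : IsMirabolic q n e t) (hq : q ≠ 0)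
    (hroot : ∀ c : ℤ, q ^ c = 1 → c = 0) {z : A} (hz : ∀ y, Commute z y)
    (hzn : z ∈ level K e t n) :
    ∃ p : MvPolynomial (Fin n) K, p.IsSymmetric ∧ orderedEval (jm q e t) n p = z := by
  classical
  obtain ⟨f, hf⟩ := h.exists_center_scalar_multiset hq hroot hz hzn
  obtain ⟨T, hT, h1⟩ := Submodule.mem_span_finite_of_mem_span
    (h.one_mem_span_weightVectors hq hroot le_rfl)
  have hw : ∀ E ∈ weightVectors q e t n, ∃ x : Fin n → K,
      IsWeight (jm q e t) (List.ofFn x) E := by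
    rintro E ⟨-, a, rfl, ha, -⟩
    exact ⟨a.get, by rwa [List.ofFn_get]⟩
  choose! x hx using hw
  obtain ⟨p, hp, hpf⟩ := exists_isSymmetric_eval_eq n
    (T.image fun E => (List.ofFn (x E) : Multiset K)) f
  refine ⟨p, hp, ?_⟩
  have key : ∀ E ∈ Submodule.span K (T : Set A), orderedEval (jm q e t) n p * E = z * E := by
    intro E hE
    induction hE using Submodule.span_induction with
    | zero => simp
    | add x y _ _ hx hy => rw [mul_add, mul_add, hx, hy]
    | smul r x _ hx => rw [mul_smul_comm, mul_smul_comm, hx]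
    | mem E hE =>
      rw [(hx E (hT hE)).orderedEval_mul, hf _ (by simp) E (hx E (hT hE)),
        hpf _ (Finset.mem_image_of_mem _ hE)]
  simpa using key 1 h1

theorem eval_eq_of_mul_gen_mul_ne_zero (h : IsMirabolic q n e t) (hq : q ≠ 0) {j : ℕ} (hj : j < n)
    {a b : Fin n → K} {u v : A} (hu : IsRowWeight (jm q e t) (List.ofFn b) u)
    (hv : IsWeight (jm q e t) (List.ofFn a) v) (hne : u * (gen e t j * v) ≠ 0)
    {p : MvPolynomial (Fin n) K} (hp : p.IsSymmetric) :
    MvPolynomial.eval b p = MvPolynomial.eval a p := by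
  have hu' : ∀ i : Fin n, u * jm q e t i = b i • u := fun i => hu i _ (by simp)
  have hv' : ∀ i : Fin n, jm q e t i * v = a i • v := fun i => hv i _ (by simp)
  -- an element commuting with the generator has the same eigenvalue on both sides
  have key : ∀ (c : A) (x y : K), Commute c (gen e t j) → u * c = x • u → c * v = y • v →
      x = y := by
    intro c x y hc hx hy
    refine smul_left_injective K hne ?_
    change x • _ = y • _
    rw [← smul_mul_assoc, ← hx, mul_assoc, hc.left_comm, hy, mul_smul_comm, mul_smul_comm]
  match j with
  | 0 =>
    have : b = a := funext fun i =>
      key _ _ _ (h.commute_jm i.2 (by omega : 0 < n)) (hu' i) (hv' i)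
    rw [this]
  | j + 1 =>
    set i0 : Fin n := ⟨j, by omega⟩ with hi0
    set i1 : Fin n := ⟨j + 1, hj⟩ with hi1
    have h0 : jm q e t j * v = a i0 • v := hv' i0
    have h1 : jm q e t (j + 1) * v = a i1 • v := hv' i1
    have g0 : u * jm q e t j = b i0 • u := hu' i0
    have g1 : u * jm q e t (j + 1) = b i1 • u := hu' i1
    have hother : ∀ i, i ≠ i0 → i ≠ i1 → b i = a i := by
      intro i hn0 hn1
      have k0 : i.1 ≠ j := fun h => hn0 (Fin.ext h)
      have k1 : i.1 ≠ j + 1 := fun h => hn1 (Fin.ext h)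
      refine key _ _ _ ?_ (hu' i) (hv' i)
      rcases Nat.lt_or_ge i j with hl | hl
      · exact (h.commute_t_jm_of_lt hl hj).symm
      · exact (h.commute_t_jm_of_gt (by omega) i.2).symm
    have hsum : b i0 + b i1 = a i0 + a i1 := by
      refine key (jm q e t j + jm q e t (j + 1)) _ _ ?_ ?_ ?_
      · change _ * t j = t j * _
        rw [add_mul, mul_add, h.jm_succ_mul_t hq hj, h.t_mul_jm_succ hq hj]
        abel
      · rw [mul_add, g0, g1, add_smul]
      · rw [add_mul, h0, h1, add_smul]
    have hprod : b i0 * b i1 = a i0 * a i1 := by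
      refine key (jm q e t j * jm q e t (j + 1)) _ _ ?_ ?_ ?_
      · have hc := (h.commute_jm (i := j) (j := j + 1) (by omega) hj).eq
        change _ * t j = t j * _
        rw [hc]
        nth_rewrite 2 [← hc]
        simp only [jm, smul_mul_assoc, mul_smul_comm, mul_assoc]
      · rw [← mul_assoc, g0, smul_mul_assoc, g1, smul_smul]
      · rw [mul_assoc, h1, mul_smul_comm, h0, smul_smul, mul_comm]
    have hz : (a i0 - b i0) * (a i0 - b i1) = 0 := by
      linear_combination (-a i0) * hsum + hprod
    rcases mul_eq_zero.1 hz with hz | hz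
    · have e0 : b i0 = a i0 := (sub_eq_zero.1 hz).symm
      have : b = a := by
        funext i
        by_cases k0 : i = i0
        · rw [k0, e0]
        by_cases k1 : i = i1
        · rw [k1]; linear_combination hsum - e0
        exact hother i k0 k1
      rw [this]
    · have e0 : a i0 = b i1 := sub_eq_zero.1 hz
      have : a = b ∘ Equiv.swap i0 i1 := by
        funext i
        by_cases k0 : i = i0
        · simp [k0, e0]
        by_cases k1 : i = i1
        · rw [k1, Function.comp_apply, Equiv.swap_apply_right]; linear_combination -hsum - e0
        rw [Function.comp_apply, Equiv.swap_apply_of_ne_of_ne k0 k1, hother i k0 k1]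
      rw [this, ← MvPolynomial.eval_rename, hp]

theorem commute_orderedEval (h : IsMirabolic q n e t) (hq : q ≠ 0)
    (hroot : ∀ c : ℤ, q ^ c = 1 → c = 0) {p : MvPolynomial (Fin n) K} (hp : p.IsSymmetric)
    {y : A} (hy : y ∈ level K e t n) : Commute (orderedEval (jm q e t) n p) y := by
  refine commute_of_mem_level (fun j hj => ?_) hy
  set z := orderedEval (jm q e t) n p with hzdef
  have hone := h.one_mem_span_weightVectors hq hroot (k := n) le_rfl
  have key : ∀ F ∈ Submodule.span K (weightVectors q e t n),
      ∀ E ∈ Submodule.span K (weightVectors q e t n),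
        F * (z * (gen e t j * E)) = F * (gen e t j * (z * E)) := by
    intro F hF E hE
    induction hF, hE using Submodule.span_induction₂ with
    | zero_left => simp
    | zero_right => simp
    | add_left x y z _ _ _ h1 h2 => rw [add_mul, add_mul, h1, h2]
    | add_right x y z _ _ _ h1 h2 => simp only [mul_add, h1, h2]
    | smul_left c x y _ _ h1 => rw [smul_mul_assoc, smul_mul_assoc, h1]
    | smul_right c x y _ _ h1 => simp only [mul_smul_comm, h1]
    | mem_mem F E hF hE =>
      obtain ⟨-, b, hb, -, hFb⟩ := hF
      obtain ⟨-, a, ha, hEa, -⟩ := hE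
      obtain ⟨b, rfl⟩ : ∃ x : Fin n → K, b = List.ofFn x := by
        subst hb; exact ⟨b.get, (List.ofFn_get b).symm⟩
      obtain ⟨a, rfl⟩ : ∃ x : Fin n → K, a = List.ofFn x := by
        subst ha; exact ⟨a.get, (List.ofFn_get a).symm⟩
      rw [hEa.orderedEval_mul, ← mul_assoc, hFb.mul_orderedEval, smul_mul_assoc, mul_smul_comm,
        mul_smul_comm]
      by_cases h0 : F * (gen e t j * E) = 0
      · simp [h0]
      · rw [h.eval_eq_of_mul_gen_mul_ne_zero hq hj hFb hEa h0 hp]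
  change z * gen e t j = gen e t j * z
  simpa using key 1 hone 1 hone

theorem of_solomon_relations (hq : q ≠ 0) {T : ℕ → A}
    (quad0 : 0 < n → T 0 * T 0 = (q - 2) • T 0 + (q - 1) • (1 : A))
    (quad : ∀ i, 1 ≤ i → i < n → T i * T i = (q - 1) • T i + q • (1 : A))
    (braid : ∀ i, 1 ≤ i → i + 1 < n → T i * T (i + 1) * T i = T (i + 1) * T i * T (i + 1))
    (rel4 : 1 < n → T 0 * T 1 * T 0 * T 1 =
      (q - 1) • (T 1 * T 0 * T 1 + T 1 * T 0) - T 0 * T 1 * T 0)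
    (rel5 : 1 < n → T 1 * T 0 * T 1 * T 0 =
      (q - 1) • (T 1 * T 0 * T 1 + T 0 * T 1) - T 0 * T 1 * T 0)
    (comm : ∀ i j, i + 2 ≤ j → j < n → T i * T j = T j * T i) :
    IsMirabolic q n (q⁻¹ • (T 0 + 1)) fun i => T (i + 1) where
  e_mul_e hn := by
    refine smul_right_injective A (mul_ne_zero hq hq) ?_
    change (q * q) • _ = (q * q) • _
    have h := quad0 hn
    simp only [smul_mul_assoc, mul_smul_comm, smul_smul, mul_add, add_mul, mul_one, one_mul]
    rw [h]
    match_scalars <;> field_simp <;> ring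
  quad i hi := quad _ (by omega) hi
  braid i hi := braid _ (by omega) (by omega)
  comm i j hij hj := comm _ _ (by omega) hj
  e_comm j hj hjn :=
    (Commute.add_left (comm 0 (j + 1) (by omega) hjn) (Commute.one_left _)).smul_left _
  e_braid hn := by
    refine smul_right_injective A (mul_ne_zero hq hq) ?_
    change (q * q) • _ = (q * q) • _
    have h4 := rel4 hn
    have h5 := rel5 hn
    have h1 := quad 1 le_rfl hn
    have h6 : T 0 * (T 1 * T 1) = (q - 1) • (T 0 * T 1) + q • T 0 := by
      rw [h1]; simp [mul_add]
    have h7 : T 1 * (T 1 * T 0) = (q - 1) • (T 1 * T 0) + q • T 0 := by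
      rw [← mul_assoc, h1]; simp [add_mul]
    simp only [mul_assoc] at h4 h5
    simp only [zero_add, smul_mul_assoc, mul_smul_comm, smul_smul, mul_add, add_mul, mul_one,
      one_mul, mul_assoc]
    rw [h4, h5, h6, h7]
    module
  e_rel hn := by
    refine smul_right_injective A (mul_ne_zero hq hq) ?_
    change (q * q) • _ = (q * q) • _
    have h5 := rel5 hn
    have h1 := quad 1 le_rfl hn
    have h7 : T 1 * (T 1 * T 0) = (q - 1) • (T 1 * T 0) + q • T 0 := by
      rw [← mul_assoc, h1]; simp [add_mul]
    simp only [mul_assoc] at h5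
    have hs : q⁻¹ * q⁻¹ = (q * q)⁻¹ := by rw [mul_inv]
    have hqq : q * q ≠ 0 := mul_ne_zero hq hq
    simp only [zero_add, smul_mul_assoc, mul_smul_comm, smul_smul, mul_add, add_mul, mul_one,
      one_mul, mul_assoc, mul_sub, sub_mul, smul_add, smul_sub]
    rw [h5, h7, h1]
    match_scalars <;> field_simp <;> ring

end IsMirabolic

theorem jm_eq_smul_prod (q : K) (e : A) (t : ℕ → A) (i : ℕ) :
    jm q e t i = (q⁻¹ ^ i) •
      (((List.range i).reverse.map t).prod * e * ((List.range i).map t).prod) := by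
  induction i with
  | zero => simp [jm]
  | succ i ih =>
    rw [jm, ih]
    simp only [List.range_succ, List.reverse_append, List.reverse_cons, List.reverse_nil,
      List.nil_append, List.cons_append, List.map_cons, List.map_append, List.map_nil,
      List.prod_cons, List.prod_append, List.prod_nil, mul_one, mul_smul_comm, smul_mul_assoc,
      smul_smul, pow_succ', mul_assoc]

end Abstract

theorem RatFunc.zpow_X_eq_one {c : ℤ} (hc : (RatFunc.X : RatFunc ℂ) ^ c = 1) : c = 0 := by
  have key : ∀ m : ℕ, (RatFunc.X : RatFunc ℂ) ^ m = 1 → m = 0 := fun m hm => by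
    rw [← RatFunc.algebraMap_X, ← map_pow, ← map_one (algebraMap (Polynomial ℂ) (RatFunc ℂ))] at hm
    simpa using congrArg Polynomial.natDegree (RatFunc.algebraMap_injective ℂ hm)
  obtain ⟨m, rfl | rfl⟩ := c.eq_nat_or_neg
  · rw [key m (by simpa using hc), Nat.cast_zero]
  · rw [key m (by simpa using hc), Nat.cast_zero, neg_zero]

section GenMirabolic

variable {n : ℕ}

theorem Tnat_of_lt {j : ℕ} (hj : j < n) : Tnat n j =
    RingQuot.mkAlgHom (RatFunc ℂ) (SolomonRel (RatFunc ℂ) RatFunc.X n)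
      (FreeAlgebra.ι (RatFunc ℂ) ⟨j, hj⟩) := by
  rw [Tnat, dif_pos hj, MirabolicHecke.T]

theorem isMirabolic_genMirabolic (n : ℕ) :
    IsMirabolic (RatFunc.X : RatFunc ℂ) n (eElt n) fun i => Tnat n (i + 1) := by
  refine IsMirabolic.of_solomon_relations RatFunc.X_ne_zero ?_ ?_ ?_ ?_ ?_ ?_
  · intro h0
    rw [Tnat_of_lt h0]
    simpa using RingQuot.mkAlgHom_rel (RatFunc ℂ)
      (SolomonRel.quad0 (K := RatFunc ℂ) (q := RatFunc.X) (⟨0, h0⟩ : Fin n) rfl)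
  · intro i h1 hi
    rw [Tnat_of_lt hi]
    simpa using RingQuot.mkAlgHom_rel (RatFunc ℂ)
      (SolomonRel.quad (K := RatFunc ℂ) (q := RatFunc.X) (⟨i, hi⟩ : Fin n) h1)
  · intro i h1 hi
    rw [Tnat_of_lt hi, Tnat_of_lt (by omega : i < n)]
    simpa using RingQuot.mkAlgHom_rel (RatFunc ℂ) (SolomonRel.braid (K := RatFunc ℂ)
      (q := RatFunc.X) (⟨i, by omega⟩ : Fin n) ⟨i + 1, hi⟩ h1 rfl)
  · intro h1
    rw [Tnat_of_lt h1, Tnat_of_lt (by omega : 0 < n)]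
    simpa using RingQuot.mkAlgHom_rel (RatFunc ℂ) (SolomonRel.rel4 (K := RatFunc ℂ)
      (q := RatFunc.X) (⟨0, by omega⟩ : Fin n) ⟨1, h1⟩ rfl rfl)
  · intro h1
    rw [Tnat_of_lt h1, Tnat_of_lt (by omega : 0 < n)]
    simpa using RingQuot.mkAlgHom_rel (RatFunc ℂ) (SolomonRel.rel5 (K := RatFunc ℂ)
      (q := RatFunc.X) (⟨0, by omega⟩ : Fin n) ⟨1, h1⟩ rfl rfl)
  · intro i j hij hj
    rw [Tnat_of_lt hj, Tnat_of_lt (by omega : i < n)]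
    simpa using RingQuot.mkAlgHom_rel (RatFunc ℂ) (SolomonRel.comm (K := RatFunc ℂ)
      (q := RatFunc.X) (⟨i, by omega⟩ : Fin n) ⟨j, hj⟩ (.inl hij))

theorem JM_succ_eq_jm (i : ℕ) :
    JM n (i + 1) = jm (RatFunc.X : RatFunc ℂ) (eElt n) (fun i => Tnat n (i + 1)) i := by
  rw [JM, jm_eq_smul_prod]
  congr 1
  rw [Nat.cast_add, Nat.cast_one, sub_add_cancel_right, zpow_neg, zpow_natCast, inv_pow]

theorem evalJM_eq_orderedEval (p : MvPolynomial (Fin n) (RatFunc ℂ)) :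
    evalJM n p = orderedEval (jm (RatFunc.X : RatFunc ℂ) (eElt n) fun i => Tnat n (i + 1)) n p := by
  simp only [evalJM, orderedEval, JM_succ_eq_jm]

theorem mem_level_genMirabolic (y : GenMirabolic n) :
    y ∈ level (RatFunc ℂ) (eElt n) (fun i => Tnat n (i + 1)) n := by
  obtain ⟨y, rfl⟩ := RingQuot.mkAlgHom_surjective (RatFunc ℂ)
    (SolomonRel (RatFunc ℂ) RatFunc.X n) y
  induction y using FreeAlgebra.induction with
  | grade0 r =>
    rw [AlgHom.commutes]
    exact Subalgebra.algebraMap_mem _ r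
  | grade1 i =>
    obtain ⟨i, hi⟩ := i
    rw [← Tnat_of_lt hi]
    match i with
    | 0 =>
      have he : eElt n ∈ level (RatFunc ℂ) (eElt n) (fun i => Tnat n (i + 1)) n :=
        gen_mem_level hi
      have h0 : Tnat n 0 = (RatFunc.X : RatFunc ℂ) • eElt n - 1 := by
        rw [eElt, smul_inv_smul₀ RatFunc.X_ne_zero, add_sub_cancel_right]
      rw [h0]
      exact sub_mem (Subalgebra.smul_mem _ he _) (one_mem _)
    | i + 1 => exact gen_mem_level hi
  | mul x y hx hy => rw [map_mul]; exact mul_mem hx hy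
  | add x y hx hy => rw [map_add]; exact add_mem hx hy

end GenMirabolic

section Stmt13

local notation "K" => RatFunc ℂ

/-- The center of the generic mirabolic Hecke algebra `ℛ_n` equals the
set of evaluations of symmetric polynomials at the Jucys–Murphy elements. -/
theorem center_eq_symmetric_evalJM (n : ℕ) :
    (Subalgebra.center K (GenMirabolic n) : Set (GenMirabolic n)) =
      {x | ∃ p : MvPolynomial (Fin n) K, p.IsSymmetric ∧ evalJM n p = x} := by
  have hM := isMirabolic_genMirabolic n
  have hq : (RatFunc.X : RatFunc ℂ) ≠ 0 := RatFunc.X_ne_zero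
  have hroot : ∀ c : ℤ, (RatFunc.X : RatFunc ℂ) ^ c = 1 → c = 0 := fun _ => RatFunc.zpow_X_eq_one
  have : Infinite (RatFunc ℂ) := Infinite.of_injective _ (RatFunc.algebraMap_injective ℂ)
  ext x
  rw [SetLike.mem_coe, Subalgebra.mem_center_iff, Set.mem_ofPred_eq]
  constructor
  · intro hx
    obtain ⟨p, hp, hpx⟩ := hM.exists_orderedEval_eq hq hroot (fun y => (hx y).symm)
      (mem_level_genMirabolic x)
    exact ⟨p, hp, by rw [evalJM_eq_orderedEval, hpx]⟩
  · rintro ⟨p, hp, rfl⟩ y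
    rw [evalJM_eq_orderedEval]
    exact (hM.commute_orderedEval hq hroot hp (mem_level_genMirabolic y)).symm.eq

end Stmt13
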